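/- arXiv:1304.7748 — 9 statements merged into one kernel-verified Lean document; each statement's English description precedes it below -/
import Mathlib

section
/- Let X be a complete metric space, Y a normed linear space, F : X ⇉ Y a closed multifunction, (x₀,y₀) ∈ gph F, V ⊆ X × Y with gph F ⊆ V, and τ ∈ (0,+∞). Suppose that the section V_x = {y : (x,y) ∈ V} is convex for every x in a neighborhood of x₀, and the section V_y = {x : (x,y) ∈ V} is open for every y in a neighborhood of y₀. If F is metrically regular relative to V at (x₀,y₀) with constant τ, then there exists δ > 0 such that the local strong slope satisfies |∇φ_V(·,y)|(x) ≥ τ⁻¹ for all (x,y) ∈ (B(x₀,δ) × B(y₀,δ)) ∩ V with d(y, F(x)) ∈ (0,δ). -/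
open Metric Set Filter Topology
open scoped ENNReal NNReal Pointwise

/-- Global strong slope of an `ℝ≥0∞`-valued function. -/
noncomputable def gslope {X : Type*} [PseudoEMetricSpace X] (g : X → ℝ≥0∞) (x : X) : ℝ≥0∞ :=
  if g x = ⊤ then ⊤ else ⨆ (y) (_ : y ≠ x), (g x - g y) / edist x y

/-- Local strong slope of an `ℝ≥0∞`-valued function. -/
noncomputable def lslope {X : Type*} [PseudoEMetricSpace X] (g : X → ℝ≥0∞) (x : X) : ℝ≥0∞ :=
  if g x = ⊤ then ⊤ else Filter.limsup (fun y => (g x - g y) / edist x y) (𝓝[≠] x)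

/-- Global strong slope of an `EReal`-valued function. -/
noncomputable def gslopeE {X : Type*} [PseudoEMetricSpace X] (f : X → EReal) (x : X) : ℝ≥0∞ :=
  if f x = ⊤ then ⊤ else ⨆ (y) (_ : y ≠ x), ENNReal.ofReal ((f x - f y).toReal) / edist x y

-- Lower semicontinuous envelope relative to `V` of `x ↦ d(y, F x)`.
open Classical in
noncomputable def phiV {X Y : Type*} [PseudoEMetricSpace X] [PseudoEMetricSpace Y]
    (F : X → Set Y) (V : Set (X × Y)) (x : X) (y : Y) : ℝ≥0∞ :=
  if x ∈ closure {u | (u, y) ∈ V} then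
    Filter.liminf (fun u => EMetric.infEdist y (F u)) (𝓝 x ⊓ 𝓟 {u | (u, y) ∈ V})
  else ⊤

/-- Metric regularity of `F` relative to `V` at `(x₀, y₀)` with constant `τ`. -/
def MetRegRel {X Y : Type*} [PseudoMetricSpace X] [PseudoMetricSpace Y]
    (F : X → Set Y) (V : Set (X × Y)) (x₀ : X) (y₀ : Y) (τ : ℝ) : Prop :=
  ∃ ε > 0, ∀ x y, dist (⟨x, y⟩ : X × Y) (x₀, y₀) < ε → (x, y) ∈ V →
    EMetric.infEdist y (F x) < ENNReal.ofReal ε →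
    EMetric.infEdist x ({u | y ∈ F u} ∩ closure {u | (u, y) ∈ V}) ≤
      ENNReal.ofReal τ * EMetric.infEdist y (F x)

/-- Conic hull of the open ball `B(ybar, δ)`. -/
def coneB {Y : Type*} [SeminormedAddCommGroup Y] [NormedSpace ℝ Y] (ybar : Y) (δ : ℝ) : Set Y :=
  {z | ∃ l : ℝ, 0 ≤ l ∧ ∃ w ∈ Metric.ball ybar δ, z = l • w}

/-- Directional metric regularity at `(x₀,y₀)` in the direction `ybar` with modulus `τ`. -/
def DirMetRegMod {X Y : Type*} [PseudoMetricSpace X] [SeminormedAddCommGroup Y] [NormedSpace ℝ Y]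
    (F : X → Set Y) (x₀ : X) (y₀ ybar : Y) (τ : ℝ) : Prop :=
  ∃ ε > 0, ∃ δ > 0, ∀ x y, x ∈ Metric.ball x₀ ε → y ∈ Metric.ball y₀ ε →
    EMetric.infEdist y (F x) < ENNReal.ofReal ε → y ∈ F x + coneB ybar δ →
    EMetric.infEdist x {u | y ∈ F u} ≤ ENNReal.ofReal τ * EMetric.infEdist y (F x)

/-- Fréchet normal cone to `C` at `z`. -/
def frechetNormalCone {E : Type*} [SeminormedAddCommGroup E] [NormedSpace ℝ E]
    (C : Set E) (z : E) : Set (E →L[ℝ] ℝ) :=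
  {f | ∀ ε > 0, ∀ᶠ u in 𝓝[C] z, f (u - z) ≤ ε * ‖u - z‖}

-- Parametric lower semicontinuous envelope relative to `V` of `x ↦ d(y, F x p)`.
open Classical in
noncomputable def phiVP {X P Y : Type*} [PseudoEMetricSpace X] [TopologicalSpace P]
    [PseudoEMetricSpace Y]
    (F : X → P → Set Y) (V : Set (X × P × Y)) (x : X) (y : Y) (p : P) : ℝ≥0∞ :=
  if x ∈ closure {u | (u, p, y) ∈ V} then
    Filter.liminf (fun u => EMetric.infEdist y (F u p)) (𝓝 x ⊓ 𝓟 {u | (u, p, y) ∈ V})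
  else ⊤

/-- Metric regularity of `F` relative to `V`, uniformly in the parameter `p`. -/
def MetRegRelUnif {X P Y : Type*} [PseudoMetricSpace X] [TopologicalSpace P] [PseudoMetricSpace Y]
    (F : X → P → Set Y) (V : Set (X × P × Y)) (x₀ : X) (p₀ : P) (y₀ : Y) (τ : ℝ) : Prop :=
  ∃ ε > 0, ∃ W ∈ 𝓝 p₀, ∀ x y p, dist (⟨x, y⟩ : X × Y) (x₀, y₀) < ε → p ∈ W → (x, p, y) ∈ V →
    EMetric.infEdist y (F x p) < ENNReal.ofReal ε →
    EMetric.infEdist x {u | y ∈ F u p} ≤ ENNReal.ofReal τ * EMetric.infEdist y (F x p)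

/-- Localization of `F` around `(x₀, y₀)` with radius `ε`. -/
def Floc {X Y : Type*} [PseudoMetricSpace X] [PseudoMetricSpace Y]
    (F : X → Set Y) (x₀ : X) (y₀ : Y) (ε : ℝ) : X → Set Y :=
  fun x => {y | x ∈ Metric.closedBall x₀ ε ∧ y ∈ F x ∧ y ∈ Metric.closedBall y₀ ε}

/-- On the section `V_y`, the envelope `phiV` lies below `x ↦ d(y, F x)`. -/
theorem phiV_le_infEdist {X Y : Type*} [PseudoEMetricSpace X] [PseudoEMetricSpace Y]
    {F : X → Set Y} {V : Set (X × Y)} {x : X} {y : Y} (h : (x, y) ∈ V) :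
    phiV F V x y ≤ Metric.infEDist y (F x) := by
  have hx : x ∈ {u | (u, y) ∈ V} := h
  rw [phiV, if_pos (subset_closure hx)]
  refine Filter.liminf_le_of_frequently_le' ?_
  have hp : pure x ≤ 𝓝 x ⊓ 𝓟 {u | (u, y) ∈ V} :=
    le_inf (pure_le_nhds x) (by simpa using hx)
  exact Frequently.filter_mono (frequently_pure.2 le_rfl) hp

/-- Near any point of the section `V_y` there are points of `V_y` at which the distance from `y`
to the image almost attains the value of `phiV`. -/
theorem frequently_infEdist_lt_of_phiV_lt {X Y : Type*} [PseudoEMetricSpace X]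
    [PseudoEMetricSpace Y] {F : X → Set Y} {V : Set (X × Y)} {x : X} {y : Y} {b : ℝ≥0∞}
    (h : (x, y) ∈ V) (hb : phiV F V x y < b) :
    ∃ᶠ u in 𝓝 x, (u, y) ∈ V ∧ Metric.infEDist y (F u) < b := by
  have hx : x ∈ {u | (u, y) ∈ V} := h
  rw [phiV, if_pos (subset_closure hx)] at hb
  have := Filter.frequently_lt_of_liminf_lt (by isBoundedDefault) hb
  rw [Filter.frequently_inf_principal] at this
  exact this

/-- If `F` has closed graph, then `phiV` vanishes at a point `(x, y)` of `V` only if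
`y ∈ F x`. -/
theorem mem_of_phiV_eq_zero {X Y : Type*} [PseudoMetricSpace X] [PseudoMetricSpace Y]
    {F : X → Set Y} {V : Set (X × Y)} {x : X} {y : Y}
    (hF : IsClosed {p : X × Y | p.2 ∈ F p.1}) (h : (x, y) ∈ V) (h0 : phiV F V x y = 0) :
    y ∈ F x := by
  have hc : (x, y) ∈ {p : X × Y | p.2 ∈ F p.1} := by
    rw [← hF.closure_eq, Metric.mem_closure_iff]
    intro r hr
    have hb : phiV F V x y < ENNReal.ofReal r := by simpa [h0] using hr
    obtain ⟨u, ⟨-, hu⟩, hux⟩ := ((frequently_infEdist_lt_of_phiV_lt h hb).and_eventually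
      (Metric.ball_mem_nhds x hr)).exists
    obtain ⟨v, hv, hyv⟩ := Metric.infEDist_lt_iff.1 hu
    rw [edist_lt_ofReal] at hyv
    refine ⟨(u, v), hv, ?_⟩
    rw [Prod.dist_eq]
    exact max_lt (by simpa [dist_comm] using hux) hyv
  exact hc

/-- Theorem 2, (i) ⟹ (iv): if `Y` is a normed space, `gph F ⊆ V`,
the sections `V_x` are convex near `x₀` and the sections `V_y` are open near `y₀`, then
metric regularity of `F` relative to `V` at `(x₀,y₀)` with constant `τ` yields a lower
bound `τ⁻¹` for the local strong slope of `φ_V(·,y)` at points of `V` near `(x₀,y₀)`. -/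
theorem stmt5 {X Y : Type*} [MetricSpace X] [CompleteSpace X]
    [NormedAddCommGroup Y] [NormedSpace ℝ Y]
    (F : X → Set Y) (hF : IsClosed {p : X × Y | p.2 ∈ F p.1})
    (x₀ : X) (y₀ : Y) (h₀ : y₀ ∈ F x₀) (V : Set (X × Y))
    (hgr : ∀ x y, y ∈ F x → (x, y) ∈ V)
    (hconv : ∀ᶠ x in 𝓝 x₀, Convex ℝ {y | (x, y) ∈ V})
    (hopen : ∀ᶠ y in 𝓝 y₀, IsOpen {x | (x, y) ∈ V})
    (τ : ℝ) (hτ : 0 < τ) (hreg : MetRegRel F V x₀ y₀ τ) :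
    ∃ δ > 0, ∀ x y, x ∈ Metric.ball x₀ δ → y ∈ Metric.ball y₀ δ → (x, y) ∈ V →
      0 < EMetric.infEdist y (F x) → EMetric.infEdist y (F x) < ENNReal.ofReal δ →
      (ENNReal.ofReal τ)⁻¹ ≤ lslope (fun u => phiV F V u y) x := by
  obtain ⟨ε, hε, hreg⟩ := hreg
  obtain ⟨δ₁, hδ₁, hconv⟩ := Metric.eventually_nhds_iff_ball.1 hconv
  obtain ⟨δ₂, hδ₂, hopen⟩ := Metric.eventually_nhds_iff_ball.1 hopen
  obtain ⟨δ, hδ, hδε, hδc, hδo⟩ : ∃ δ > 0, 3 * δ ≤ ε ∧ 2 * δ ≤ δ₁ ∧ δ ≤ δ₂ := by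
    refine ⟨min (ε / 3) (min (δ₁ / 2) δ₂), by positivity, ?_, ?_, ?_⟩
    · linarith [min_le_left (ε / 3) (min (δ₁ / 2) δ₂)]
    · linarith [min_le_right (ε / 3) (min (δ₁ / 2) δ₂), min_le_left (δ₁ / 2) δ₂]
    · linarith [min_le_right (ε / 3) (min (δ₁ / 2) δ₂), min_le_right (δ₁ / 2) δ₂]
  refine ⟨δ, hδ, fun x y hx hy hxy hpos hlt => ?_⟩
  have hφlt : phiV F V x y < ENNReal.ofReal δ := (phiV_le_infEdist hxy).trans_lt hlt
  have hφtop : phiV F V x y ≠ ⊤ := hφlt.ne_top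
  have hφ0 : phiV F V x y ≠ 0 := fun h0 =>
    hpos.ne' (Metric.infEDist_zero_of_mem (mem_of_phiV_eq_zero hF hxy h0))
  obtain ⟨p, hp⟩ : ∃ p, p = (phiV F V x y).toReal := ⟨_, rfl⟩
  have hp0 : 0 < p := hp ▸ ENNReal.toReal_pos hφ0 hφtop
  have hφp : phiV F V x y = ENNReal.ofReal p := by rw [hp, ENNReal.ofReal_toReal hφtop]
  have hpδ : p < δ := by
    rw [hφp] at hφlt
    exact (ENNReal.ofReal_lt_ofReal_iff hδ).1 hφlt
  rw [lslope, if_neg hφtop]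
  refine le_of_forall_lt_imp_le_of_dense fun a ha => ?_
  obtain ⟨c, hc0, rfl⟩ : ∃ c : ℝ, 0 ≤ c ∧ a = ENNReal.ofReal c :=
    ⟨a.toReal, ENNReal.toReal_nonneg, (ENNReal.ofReal_toReal ha.ne_top).symm⟩
  have hcτ : c * τ < 1 := by
    rw [← ENNReal.ofReal_inv_of_pos hτ, ENNReal.ofReal_lt_ofReal_iff (by positivity)] at ha
    rwa [← lt_div_iff₀ hτ, one_div]
  obtain ⟨τ', hττ', hcτ'⟩ : ∃ τ', τ < τ' ∧ c * τ' < 1 := by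
    have : Tendsto (fun s => c * s) (𝓝[>] τ) (𝓝 (c * τ)) :=
      ((continuous_const_mul c).tendsto τ).mono_left nhdsWithin_le_nhds
    obtain ⟨s, hs, hs'⟩ := ((this.eventually_lt_const hcτ).and self_mem_nhdsWithin).exists
    exact ⟨s, hs', hs⟩
  have hτ'0 : 0 < τ' := hτ.trans hττ'
  refine Filter.le_limsup_of_frequently_le' ?_
  rw [frequently_nhdsWithin_iff, Metric.nhds_basis_ball.frequently_iff]
  intro ρ₁ hρ₁
  obtain ⟨ρ₂, hρ₂, hVρ₂⟩ := Metric.isOpen_iff.1 (hopen y (Metric.ball_subset_ball hδo hy)) x hxy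
  obtain ⟨ρ, hρ, hρρ₁, hρρ₂⟩ : ∃ ρ > 0, ρ ≤ ρ₁ ∧ ρ ≤ ρ₂ :=
    ⟨min ρ₁ ρ₂, lt_min hρ₁ hρ₂, min_le_left _ _, min_le_right _ _⟩
  obtain ⟨t, ht0, ht1, htρ⟩ : ∃ t > 0, t < 1 ∧ τ' * t * (2 * δ) ≤ ρ / 2 := by
    refine ⟨min (1 / 2) (ρ / 2 / (τ' * (2 * δ))), by positivity, ?_, ?_⟩
    · exact (min_le_left _ _).trans_lt (by norm_num)
    · have := min_le_right (1 / 2) (ρ / 2 / (τ' * (2 * δ)))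
      rw [le_div_iff₀ (by positivity)] at this
      linarith
  obtain ⟨s, hs0, hsδ, hsρ, hs⟩ : ∃ s > 0, s < δ ∧ s < ρ / 2 ∧
      s * (c + c * τ' * t + 1) < t * p * (1 - c * τ') := by
    have hcs : Tendsto (fun s : ℝ => s * (c + c * τ' * t + 1)) (𝓝[>] 0) (𝓝 0) := by
      have : Continuous fun s : ℝ => s * (c + c * τ' * t + 1) := by fun_prop
      simpa using (this.tendsto 0).mono_left nhdsWithin_le_nhds
    have hpos' : 0 < t * p * (1 - c * τ') := mul_pos (by positivity) (by linarith)
    have hid : Tendsto (fun s : ℝ => s) (𝓝[>] 0) (𝓝 0) := nhdsWithin_le_nhds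
    obtain ⟨s, h1, h2, h3, h4⟩ := ((hid.eventually_lt_const hδ).and
      ((hid.eventually_lt_const (half_pos hρ)).and
        ((hcs.eventually_lt_const hpos').and self_mem_nhdsWithin))).exists
    exact ⟨s, h4, h1, h2, h3⟩
  have hφs : phiV F V x y < ENNReal.ofReal (p + s) := by
    rw [hφp, ENNReal.ofReal_lt_ofReal_iff (by positivity)]
    linarith
  obtain ⟨u, ⟨huV, hu⟩, hux⟩ := ((frequently_infEdist_lt_of_phiV_lt hxy hφs).and_eventually
    (Metric.ball_mem_nhds x hs0)).exists
  rw [Metric.mem_ball] at hx hy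
  obtain ⟨v, hv, hyv⟩ := Metric.infEDist_lt_iff.1 hu
  rw [edist_lt_ofReal] at hyv
  have hux₀ : dist u x₀ < 2 * δ := by linarith [dist_triangle u x x₀]
  -- the point of the segment `[v, y]` to which regularity is applied
  obtain ⟨z, hz⟩ : ∃ z, z = AffineMap.lineMap v y t := ⟨_, rfl⟩
  have hzV : (u, z) ∈ V := by
    have := (hconv u (Metric.ball_subset_ball hδc (by simpa using hux₀))).lineMap_mem
      (hgr u v hv) huV ⟨ht0.le, ht1.le⟩
    rwa [← hz] at this
  have hzv : dist z v = t * dist y v := by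
    rw [hz, dist_lineMap_left, Real.norm_of_nonneg ht0.le, dist_comm]
  have hzy : dist y z = (1 - t) * dist y v := by
    rw [hz, dist_comm, dist_lineMap_right, Real.norm_of_nonneg (by linarith), dist_comm]
  have hyv0 : 0 ≤ dist y v := dist_nonneg
  have hzFu : Metric.infEDist z (F u) ≤ ENNReal.ofReal (t * dist y v) := by
    rw [← hzv, ← edist_dist]
    exact Metric.infEDist_le_edist_of_mem hv
  have hreg' := hreg u z (by
      rw [Prod.dist_eq]
      refine max_lt (by simp only; linarith) ?_
      have := dist_triangle z y y₀
      rw [dist_comm z y] at this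
      simp only
      nlinarith) hzV
    (hzFu.trans_lt ((ENNReal.ofReal_lt_ofReal_iff hε).2 (by nlinarith)))
  have hlt' : Metric.infEDist u ({w | z ∈ F w} ∩ closure {w | (w, z) ∈ V}) <
      ENNReal.ofReal (τ' * (t * (p + s))) := by
    refine (hreg'.trans (mul_le_mul_right hzFu _)).trans_lt ?_
    rw [← ENNReal.ofReal_mul hτ.le, ENNReal.ofReal_lt_ofReal_iff (by positivity)]
    have h1 : t * dist y v < t * (p + s) := mul_lt_mul_of_pos_left hyv ht0
    exact mul_lt_mul'' hττ' h1 hτ.le (by positivity)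
  obtain ⟨x', ⟨hx'z, -⟩, hux'⟩ := Metric.infEDist_lt_iff.1 hlt'
  rw [edist_lt_ofReal] at hux'
  have hxx' : dist x x' < s + τ' * (t * (p + s)) := by
    rw [dist_comm u x] at hux
    linarith [dist_triangle x u x']
  have hxx'ρ : dist x' x < ρ := by
    have : τ' * t * (p + s) ≤ τ' * t * (2 * δ) :=
      mul_le_mul_of_nonneg_left (by linarith) (by positivity)
    rw [dist_comm]
    linarith
  have hx'V : (x', y) ∈ V := hVρ₂ (Metric.mem_ball.2 (hxx'ρ.trans_le hρρ₂))
  have hφx' : phiV F V x' y ≤ ENNReal.ofReal ((1 - t) * dist y v) := by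
    refine (phiV_le_infEdist hx'V).trans ?_
    rw [← hzy, ← edist_dist]
    exact Metric.infEDist_le_edist_of_mem hx'z
  have hkey : c * dist x x' ≤ p - (1 - t) * dist y v := by
    have h1 : c * dist x x' ≤ c * (s + τ' * (t * (p + s))) := mul_le_mul_of_nonneg_left hxx'.le hc0
    have h2 : (1 - t) * dist y v ≤ (1 - t) * (p + s) :=
      mul_le_mul_of_nonneg_left hyv.le (by linarith)
    nlinarith
  have hdecr : (1 - t) * dist y v < p := by
    have h2 : (1 - t) * dist y v ≤ (1 - t) * (p + s) :=
      mul_le_mul_of_nonneg_left hyv.le (by linarith)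
    have h3 : 0 ≤ s * (c + c * τ' * t) := by positivity
    have h4 : 0 ≤ t * p * (c * τ') := by positivity
    nlinarith
  have hne : x' ≠ x := by
    rintro rfl
    rw [hφp, ENNReal.ofReal_le_ofReal_iff'] at hφx'
    rcases hφx' with h | h <;> linarith
  refine ⟨x', Metric.mem_ball.2 (hxx'ρ.trans_le hρρ₁), ?_, hne⟩
  rw [ENNReal.le_div_iff_mul_le (Or.inl (edist_pos.2 hne.symm).ne') (Or.inl (edist_ne_top _ _)),
    edist_dist, ← ENNReal.ofReal_mul hc0]
  refine (ENNReal.ofReal_le_ofReal hkey).trans ?_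
  rw [ENNReal.ofReal_sub _ (mul_nonneg (by linarith) hyv0), hφp]
  exact tsub_le_tsub_left hφx' _
end

section
/- Let X be a metric space, Y a normed linear space, and F : X ⇉ Y a multifunction such that F(x) is convex for all x near x₀, with (x₀,y₀) ∈ gph F. Then for any ȳ ∈ Y and any δ₁, δ₂ > 0, there exist η, δ > 0 such that for all x ∈ B(x₀,η): (F(x) + cone B(ȳ,δ)) ∩ B(y₀,η) ∩ {y ∈ Y : d(y, F(x)) < η} ⊆ F(x) ∩ B(y₀,δ₁) + cone B(ȳ,δ₂). -/
open Metric Set Filter Topology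
open scoped ENNReal NNReal Pointwise

/-- Lemma on localization of the directional cone: if `F` has convex
values near `x₀`, then for any `ybar` and `δ₁, δ₂ > 0` there exist `η, δ > 0` such that
for all `x ∈ B(x₀,η)`,
`(F(x) + cone B(ybar,δ)) ∩ B(y₀,η) ∩ {y : d(y,F(x)) < η} ⊆ F(x) ∩ B(y₀,δ₁) + cone B(ybar,δ₂)`. -/
theorem stmt8 {X Y : Type*} [MetricSpace X] [NormedAddCommGroup Y] [NormedSpace ℝ Y]
    (F : X → Set Y) (x₀ : X) (y₀ : Y) (h₀ : y₀ ∈ F x₀)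
    (hconv : ∀ᶠ x in 𝓝 x₀, Convex ℝ (F x))
    (ybar : Y) (δ₁ δ₂ : ℝ) (hδ₁ : 0 < δ₁) (hδ₂ : 0 < δ₂) :
    ∃ η > 0, ∃ δ > 0, ∀ x ∈ Metric.ball x₀ η,
      (F x + coneB ybar δ) ∩ Metric.ball y₀ η ∩
          {y | EMetric.infEdist y (F x) < ENNReal.ofReal η} ⊆
        (F x ∩ Metric.ball y₀ δ₁) + coneB ybar δ₂ := by
  obtain ⟨r, hr, hconv⟩ := Metric.eventually_nhds_iff_ball.1 hconv
  have hK : 0 < 2 * δ₂ + ‖ybar‖ := by positivity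
  set s := δ₁ / (2 * δ₂ + ‖ybar‖) with hs
  have hs0 : 0 < s := by positivity
  have hsK : s * (2 * δ₂ + ‖ybar‖) = δ₁ := div_mul_cancel₀ _ hK.ne'
  have hη : min r (s * δ₂ / 2) ≤ s * δ₂ / 2 := min_le_right _ _
  refine ⟨min r (s * δ₂ / 2), by positivity, δ₂ / 2, by positivity, ?_⟩
  rintro x hx y ⟨⟨hyF, hy⟩, hyd⟩
  obtain ⟨u, hu, z, ⟨l, hl, w, hw, rfl⟩, rfl⟩ := hyF
  obtain ⟨v, hv, hyv⟩ := Metric.infEDist_lt_iff.1 hyd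
  rw [edist_lt_ofReal, dist_eq_norm] at hyv
  have hC : Convex ℝ (F x) := hconv x (Metric.ball_subset_ball (min_le_left _ _) hx)
  rw [Metric.mem_ball, dist_eq_norm] at hy hw
  have hw' : ‖w‖ < ‖ybar‖ + δ₂ / 2 := by
    have := norm_le_norm_add_norm_sub' w ybar
    linarith
  dsimp only at hy hyv ⊢
  rcases le_or_gt l s with hls | hls
  · refine ⟨u, ⟨hu, ?_⟩, l • w, ⟨l, hl, w, ?_, rfl⟩, rfl⟩
    · rw [Metric.mem_ball, dist_eq_norm]
      have h1 : ‖u - y₀‖ ≤ ‖u + l • w - y₀‖ + ‖l • w‖ := by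
        have := norm_sub_le (u + l • w - y₀) (l • w)
        rwa [show u + l • w - y₀ - l • w = u - y₀ by abel] at this
      rw [norm_smul, Real.norm_of_nonneg hl] at h1
      have h2 : l * ‖w‖ ≤ s * (‖ybar‖ + δ₂ / 2) := by gcongr
      nlinarith
    · rw [Metric.mem_ball, dist_eq_norm]
      linarith
  · have hl0 : 0 < l := hs0.trans hls
    have ht0 : 0 ≤ s / l := by positivity
    have ht1 : s / l ≤ 1 := (div_le_one hl0).2 hls.le
    set a := 1 - s / l with ha
    have ha0 : 0 ≤ a := by linarith
    have ha1 : a ≤ 1 := by linarith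
    have htl : s / l * l = s := div_mul_cancel₀ _ hl0.ne'
    set q := u + l • w - v with hq
    have haq : ‖a • q‖ ≤ ‖q‖ := by
      rw [norm_smul, Real.norm_of_nonneg ha0]
      exact mul_le_of_le_one_left (norm_nonneg _) ha1
    have hsum : a • v + (s / l) • u + (a • q + s • w) = u + l • w := by
      rw [hq, ha, show s • w = (s / l) • l • w by rw [smul_smul, htl]]
      module
    refine ⟨a • v + (s / l) • u, ⟨hC hv hu ha0 ht0 (by rw [ha]; ring), ?_⟩, a • q + s • w,
      ⟨s, hs0.le, s⁻¹ • (a • q) + w, ?_, ?_⟩, hsum⟩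
    · rw [Metric.mem_ball, dist_eq_norm]
      have h1 := norm_sub_le (u + l • w - y₀) (a • q + s • w)
      rw [show u + l • w - y₀ - (a • q + s • w) = a • v + (s / l) • u - y₀ by
        rw [← hsum]; abel] at h1
      have h2 := norm_add_le (a • q) (s • w)
      rw [norm_smul s, Real.norm_of_nonneg hs0.le] at h2
      have h3 : s * ‖w‖ ≤ s * (‖ybar‖ + δ₂ / 2) := by gcongr
      nlinarith
    · rw [Metric.mem_ball, dist_eq_norm, add_sub_assoc]
      have h1 := norm_add_le (s⁻¹ • (a • q)) (w - ybar)
      rw [norm_smul s⁻¹, Real.norm_of_nonneg (inv_nonneg.2 hs0.le)] at h1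
      have h2 : s⁻¹ * ‖a • q‖ ≤ δ₂ / 2 := by
        rw [inv_mul_le_iff₀ hs0]
        linarith
      linarith
    · rw [smul_add, smul_inv_smul₀ hs0.ne']
end

section
/- Let X be a metric space, Y a normed linear space, and F : X ⇉ Y a multifunction with F(x) convex for all x near x₀, with (x₀,y₀) ∈ gph F, and let ȳ ∈ Y. Then F is directionally metrically regular at (x₀,y₀) in the direction ȳ if and only if for every ε > 0 the localization F_{(x₀,y₀,ε)} is directionally metrically regular at (x₀,y₀) in the direction ȳ, where F_{(x₀,y₀,ε)}(x) := F(x) ∩ B̄(y₀,ε) if x ∈ B̄(x₀,ε) and F_{(x₀,y₀,ε)}(x) := ∅ otherwise. -/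
open Metric Set Filter Topology
open scoped ENNReal NNReal Pointwise

/-- The infimum distance to `S` is controlled by that to any set containing the part of `S`
in a ball whose radius exceeds it. -/
lemma infEdist_le_of_inter_ball_subset {Z : Type*} [PseudoMetricSpace Z] {x : Z} {S T : Set Z}
    {r : ℝ} (hlt : Metric.infEDist x S < ENNReal.ofReal r) (hsub : S ∩ Metric.ball x r ⊆ T) :
    Metric.infEDist x T ≤ Metric.infEDist x S := by
  refine le_of_forall_gt fun c hc => ?_
  obtain ⟨z, hzS, hz⟩ := Metric.infEDist_lt_iff.1 (lt_min hc hlt)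
  obtain ⟨hzc, hzr⟩ := lt_min_iff.1 hz
  refine Metric.infEDist_lt_iff.2 ⟨z, hsub ⟨hzS, ?_⟩, hzc⟩
  rw [edist_dist] at hzr
  rw [Metric.mem_ball']
  exact (ENNReal.ofReal_lt_ofReal_iff_of_nonneg dist_nonneg).1 hzr

lemma coneB_mono {Y : Type*} [SeminormedAddCommGroup Y] [NormedSpace ℝ Y] {ybar : Y} {δ δ' : ℝ}
    (h : δ ≤ δ') : coneB ybar δ ⊆ coneB ybar δ' := by
  rintro _ ⟨l, hl, w, hw, rfl⟩
  exact ⟨l, hl, w, Metric.ball_subset_ball h hw, rfl⟩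

/-- If a convex set has a point close to `y` and `y` is reached from it along the cone, then `y`
is reached, along a slightly larger cone, from a point of the set within bounded distance. -/
lemma Convex.exists_norm_sub_le_of_mem_add_coneB {Y : Type*} [SeminormedAddCommGroup Y]
    [NormedSpace ℝ Y] {C : Set Y} (hC : Convex ℝ C) {y z ybar : Y} {δ η r : ℝ} (hδ : 0 < δ)
    (hr : 0 < r) (hy : y ∈ C + coneB ybar (δ / 2)) (hz : z ∈ C) (hzy : ‖y - z‖ ≤ η)
    (hη : η * (‖ybar‖ + δ) ≤ r * (δ / 2)) :
    ∃ v ∈ C, ‖y - v‖ ≤ η + r ∧ y - v ∈ coneB ybar δ := by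
  have hη0 : 0 ≤ η := (norm_nonneg _).trans hzy
  obtain ⟨c, hc, _, ⟨l, hl, w, hw, rfl⟩, rfl⟩ := hy
  simp only [Metric.mem_ball, dist_eq_norm] at hw
  have hwn : ‖w‖ ≤ ‖ybar‖ + δ := by
    have := norm_le_norm_add_norm_sub' w ybar
    linarith
  rcases le_or_gt (l * ‖w‖) r with hle | hgt
  · refine ⟨c, hc, ?_, l, hl, w, ?_, by simp⟩
    · simp only [add_sub_cancel_left, norm_smul, Real.norm_eq_abs, abs_of_nonneg hl]
      linarith
    · rw [Metric.mem_ball, dist_eq_norm]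
      linarith
  · have hlw : 0 < l * ‖w‖ := hr.trans hgt
    have hl0 : 0 < l := pos_of_mul_pos_left hlw (norm_nonneg w)
    have hw0 : 0 < ‖w‖ := pos_of_mul_pos_right hlw hl
    set t : ℝ := r / (l * ‖w‖) with ht
    have ht0 : 0 < t := div_pos hr hlw
    have ht1 : t ≤ 1 := (div_le_one hlw).2 hgt.le
    have htlw : t * l * ‖w‖ = r := by rw [ht]; field_simp
    have htl : 0 < t * l := mul_pos ht0 hl0
    have hdiff : c + l • w - ((1 - t) • z + t • c) =
        (1 - t) • (c + l • w - z) + (t * l) • w := by module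
    have hsmall : ‖(1 - t) • (c + l • w - z)‖ ≤ η := by
      rw [norm_smul, Real.norm_eq_abs, abs_of_nonneg (by linarith)]
      nlinarith [norm_nonneg (c + l • w - z)]
    refine ⟨(1 - t) • z + t • c, hC hz hc (by linarith) ht0.le (by ring), ?_, ?_⟩
    · rw [hdiff]
      refine (norm_add_le _ _).trans (add_le_add hsmall ?_)
      rw [norm_smul, Real.norm_eq_abs, abs_of_pos htl, htlw]
    · refine ⟨t * l, htl.le, w + (t * l)⁻¹ • ((1 - t) • (c + l • w - z)), ?_, ?_⟩
      · have hcorr : ‖(t * l)⁻¹ • ((1 - t) • (c + l • w - z))‖ ≤ δ / 2 := by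
          rw [norm_smul, norm_inv, Real.norm_eq_abs, abs_of_pos htl, inv_mul_le_iff₀ htl]
          refine hsmall.trans (le_of_mul_le_mul_right ?_ hw0)
          calc η * ‖w‖ ≤ η * (‖ybar‖ + δ) := by gcongr
            _ ≤ r * (δ / 2) := hη
            _ = t * l * (δ / 2) * ‖w‖ := by rw [← htlw]; ring
        rw [Metric.mem_ball, dist_eq_norm, add_sub_right_comm]
        exact (norm_add_le _ _).trans_lt (by linarith)
      · rw [hdiff, smul_add, smul_inv_smul₀ htl.ne', add_comm]

lemma Floc_subset {X Y : Type*} [PseudoMetricSpace X] [PseudoMetricSpace Y]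
    (F : X → Set Y) (x₀ : X) (y₀ : Y) (ε : ℝ) (x : X) : Floc F x₀ y₀ ε x ⊆ F x :=
  fun _ h => h.2.1

lemma DirMetRegMod.floc {X Y : Type*} [PseudoMetricSpace X] [SeminormedAddCommGroup Y]
    [NormedSpace ℝ Y] {F : X → Set Y} {x₀ : X} {y₀ ybar : Y} {τ : ℝ} (hτ : 0 < τ)
    (h : DirMetRegMod F x₀ y₀ ybar τ) {ε : ℝ} (hε : 0 < ε) :
    DirMetRegMod (Floc F x₀ y₀ ε) x₀ y₀ ybar τ := by
  obtain ⟨e, he, δ, hδ, H⟩ := h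
  refine ⟨min e (min (ε / 2) (ε / 2 / τ)), by positivity, δ, hδ, fun x y hx hy hd hmem => ?_⟩
  simp only [Metric.mem_ball, lt_min_iff] at hx hy
  have hanti : Metric.infEDist y (F x) ≤ Metric.infEDist y (Floc F x₀ y₀ ε x) :=
    Metric.infEDist_anti (Floc_subset F x₀ y₀ ε x)
  have hreg := H x y hx.1 hy.1
    (hanti.trans_lt (hd.trans_le (ENNReal.ofReal_le_ofReal (min_le_left _ _))))
    (Set.add_subset_add_right (Floc_subset F x₀ y₀ ε x) hmem)
  have hle := hreg.trans (mul_le_mul_right hanti (ENNReal.ofReal τ))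
  have hlt : Metric.infEDist x {u | y ∈ F u} < ENNReal.ofReal (ε / 2) := by
    refine hle.trans_lt ?_
    have hd' := hd.trans_le (ENNReal.ofReal_le_ofReal
      ((min_le_right _ _).trans (min_le_right _ _)))
    calc ENNReal.ofReal τ * Metric.infEDist y (Floc F x₀ y₀ ε x)
        < ENNReal.ofReal τ * ENNReal.ofReal (ε / 2 / τ) :=
          ENNReal.mul_lt_mul_right (ENNReal.ofReal_pos.2 hτ).ne' ENNReal.ofReal_ne_top hd'
      _ = ENNReal.ofReal (ε / 2) := by
          rw [← ENNReal.ofReal_mul hτ.le, mul_div_cancel₀ _ hτ.ne']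
  refine (infEdist_le_of_inter_ball_subset hlt ?_).trans hle
  rintro u ⟨hu, hux⟩
  refine ⟨?_, hu, ?_⟩
  · have := dist_triangle u x x₀
    rw [Metric.mem_ball] at hux
    rw [Metric.mem_closedBall]
    linarith [hx.2.1]
  · rw [Metric.mem_closedBall]
    linarith [hy.2.1]

lemma DirMetRegMod.of_floc {X Y : Type*} [PseudoMetricSpace X] [SeminormedAddCommGroup Y]
    [NormedSpace ℝ Y] {F : X → Set Y} {x₀ : X} {y₀ ybar : Y} {τ ε : ℝ} (hε : 0 < ε)
    (hconv : ∀ᶠ x in 𝓝 x₀, Convex ℝ (F x))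
    (h : DirMetRegMod (Floc F x₀ y₀ ε) x₀ y₀ ybar τ) :
    DirMetRegMod F x₀ y₀ ybar τ := by
  obtain ⟨e, he, δ, hδ, H⟩ := h
  obtain ⟨ρ, hρ, hball⟩ := Metric.eventually_nhds_iff.1 hconv
  set η : ℝ := min (ε / 4) (ε / 2 * (δ / 2) / (‖ybar‖ + δ))
  have hpos : 0 < ‖ybar‖ + δ := by positivity
  have hη0 : 0 < η := by positivity
  have hη1 : η ≤ ε / 4 := min_le_left _ _
  have hη2 : η * (‖ybar‖ + δ) ≤ ε / 2 * (δ / 2) := (le_div_iff₀ hpos).1 (min_le_right _ _)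
  refine ⟨min e (min ρ η), by positivity, δ / 2, by positivity, fun x y hx hy hd hmem => ?_⟩
  simp only [Metric.mem_ball, lt_min_iff] at hx hy
  have hxε : x ∈ Metric.closedBall x₀ ε := by
    rw [Metric.mem_closedBall]
    linarith [hx.2.2]
  have hdη := hd.trans_le (ENNReal.ofReal_le_ofReal ((min_le_right _ _).trans (min_le_right _ _)))
  have hloc : Metric.infEDist y (Floc F x₀ y₀ ε x) ≤ Metric.infEDist y (F x) := by
    refine infEdist_le_of_inter_ball_subset hdη ?_
    rintro z ⟨hz, hzy⟩
    refine ⟨hxε, hz, ?_⟩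
    have := dist_triangle z y y₀
    rw [Metric.mem_ball] at hzy
    rw [Metric.mem_closedBall]
    linarith [hy.2.2]
  obtain ⟨z, hz, hzy⟩ := Metric.infEDist_lt_iff.1 hdη
  rw [edist_dist, ENNReal.ofReal_lt_ofReal_iff hη0, dist_eq_norm] at hzy
  obtain ⟨v, hv, hvy, hvc⟩ := (hball hx.2.1).exists_norm_sub_le_of_mem_add_coneB hδ (half_pos hε)
    hmem hz hzy.le hη2
  have hvloc : v ∈ Floc F x₀ y₀ ε x := by
    refine ⟨hxε, hv, ?_⟩
    have := dist_triangle_left v y₀ y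
    rw [dist_eq_norm y v] at this
    rw [Metric.mem_closedBall]
    linarith [hy.2.2]
  calc Metric.infEDist x {u | y ∈ F u}
      ≤ Metric.infEDist x {u | y ∈ Floc F x₀ y₀ ε u} :=
        Metric.infEDist_anti fun u hu => Floc_subset F x₀ y₀ ε u hu
    _ ≤ ENNReal.ofReal τ * Metric.infEDist y (Floc F x₀ y₀ ε x) :=
        H x y hx.1 hy.1
          (hloc.trans_lt (hd.trans_le (ENNReal.ofReal_le_ofReal (min_le_left _ _))))
          ⟨v, hvloc, y - v, hvc, add_sub_cancel v y⟩
    _ ≤ ENNReal.ofReal τ * Metric.infEDist y (F x) := by gcongr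

/-- Corollary on localization: if `F` has convex values near `x₀`,
then `F` is directionally metrically regular at `(x₀,y₀)` in the direction `ybar` iff
every localization `F_{(x₀,y₀,ε)}` is. -/
theorem stmt9 {X Y : Type*} [MetricSpace X] [NormedAddCommGroup Y] [NormedSpace ℝ Y]
    (F : X → Set Y) (x₀ : X) (y₀ : Y) (h₀ : y₀ ∈ F x₀)
    (hconv : ∀ᶠ x in 𝓝 x₀, Convex ℝ (F x)) (ybar : Y) :
    (∃ τ > 0, DirMetRegMod F x₀ y₀ ybar τ) ↔
      ∀ ε > 0, ∃ τ > 0, DirMetRegMod (Floc F x₀ y₀ ε) x₀ y₀ ybar τ := by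
  constructor
  · rintro ⟨τ, hτ, h⟩ ε hε
    exact ⟨τ, hτ, h.floc hτ hε⟩
  · intro h
    obtain ⟨τ, hτ, h⟩ := h 1 one_pos
    exact ⟨τ, hτ, h.of_floc one_pos hconv⟩
end

section
/- Let C be a subset of a metric space X, let x₀ ∈ C and ε > 0, and let f : X → ℝ ∪ {+∞} be Lipschitz on B(x₀,2ε) with constant L > 0. Then for every t ≥ L: inf{ f(x) : x ∈ C ∩ B(x₀,2ε) } ≤ inf{ f(x) + t·d(x,C) : x ∈ B(x₀,ε) }. -/
open Metric Set Filter Topology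
open scoped ENNReal NNReal Pointwise

/-- penalalization lemma à la Clarke: if `f` is Lipschitz with
constant `L` on `B(x₀,2ε)`, `x₀ ∈ C` and `t ≥ L`, then
`inf {f(x) : x ∈ C ∩ B(x₀,2ε)} ≤ inf {f(x) + t d(x,C) : x ∈ B(x₀,ε)}`. -/
theorem stmt11 {X : Type*} [MetricSpace X] (C : Set X) (x₀ : X) (hx₀ : x₀ ∈ C)
    (ε : ℝ) (hε : 0 < ε) (f : X → EReal) (L : ℝ) (hL : 0 < L)
    (hf : ∀ x ∈ Metric.ball x₀ (2 * ε), ∀ y ∈ Metric.ball x₀ (2 * ε),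
      f x ≤ f y + ((L * dist x y : ℝ) : EReal))
    (t : ℝ) (ht : L ≤ t) :
    sInf (f '' (C ∩ Metric.ball x₀ (2 * ε))) ≤
      sInf ((fun x => f x + ((ENNReal.ofReal t * EMetric.infEdist x C : ℝ≥0∞) : EReal)) ''
        (Metric.ball x₀ ε)) := by
  refine le_sInf ?_
  rintro _ ⟨x, hx, rfl⟩
  have hx2 : x ∈ ball x₀ (2 * ε) := ball_subset_ball (by linarith) hx
  have hpen : ((ENNReal.ofReal t * EMetric.infEdist x C : ℝ≥0∞) : EReal) =
      ((t * infDist x C : ℝ) : EReal) := by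
    have htop : infEDist x C ≠ ⊤ := infEDist_ne_top ⟨x₀, hx₀⟩
    change ((ENNReal.ofReal t * infEDist x C : ℝ≥0∞) : EReal) = _
    rw [← ENNReal.ofReal_toReal htop, ← ENNReal.ofReal_mul (hL.le.trans ht),
      EReal.coe_ennreal_ofReal, max_eq_left (mul_nonneg (hL.le.trans ht) ENNReal.toReal_nonneg)]
    rfl
  have hxε : infDist x C < ε := (infDist_le_dist_of_mem hx₀).trans_lt hx
  have hnear : ∀ c > infDist x C,
      sInf (f '' (C ∩ ball x₀ (2 * ε))) ≤ f x + ((L * c : ℝ) : EReal) := by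
    intro c hc
    obtain ⟨z, hzC, hz⟩ := (infDist_lt_iff ⟨x₀, hx₀⟩).1 (lt_min hc hxε)
    obtain ⟨hzc, hzε⟩ := lt_min_iff.1 hz
    have hz2 : z ∈ ball x₀ (2 * ε) := by
      have := dist_triangle z x x₀
      rw [dist_comm z x] at this
      rw [mem_ball] at hx ⊢
      linarith
    refine (sInf_le (mem_image_of_mem f (mem_inter hzC hz2))).trans ((hf z hz2 x hx2).trans ?_)
    gcongr
    rw [dist_comm]
    exact hzc.le
  change _ ≤ f x + _
  rw [hpen]
  suffices h : sInf (f '' (C ∩ ball x₀ (2 * ε))) ≤ f x + ((L * infDist x C : ℝ) : EReal) by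
    refine h.trans ?_
    gcongr
    exact infDist_nonneg
  induction hfx : f x with
  | bot => simpa [hfx] using hnear _ hxε
  | top => rw [EReal.top_add_coe]; exact le_top
  | coe a =>
    have hlim : Tendsto (fun c : ℝ => ((a + L * c : ℝ) : EReal)) (𝓝[>] infDist x C)
        (𝓝 ((a + L * infDist x C : ℝ) : EReal)) :=
      ((continuous_coe_real_ereal.comp (by fun_prop)).tendsto _).mono_left nhdsWithin_le_nhds
    rw [← EReal.coe_add]
    refine ge_of_tendsto hlim ?_
    filter_upwards [self_mem_nhdsWithin] with c hc
    simpa [hfx] using hnear c hc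
end

section
/- Let X, Y be Banach spaces, let F : X ⇉ Y be a multifunction whose graph is closed and convex, let (x₀,y₀) ∈ gph F and ȳ ∈ Y. Suppose x₀ belongs to the interior of F⁻¹(Y) = Dom F. Then F is directionally metrically regular at (x₀,y₀) in the direction ȳ if and only if cone{ȳ} ∩ Int(F(X) − y₀) ≠ ∅, where F(X) = ∪_{x ∈ X} F(x) and cone{ȳ} = {λȳ : λ ≥ 0}. -/
open Metric Set Filter Topology
open scoped ENNReal NNReal Pointwise

/-- A closed convex set with bounded first projection in a product of Banach spaces has a second
projection that contains the interior of its closure. -/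
theorem interior_closure_image_snd_subset {X Y : Type*} [NormedAddCommGroup X] [NormedSpace ℝ X]
    [CompleteSpace X] [NormedAddCommGroup Y] [NormedSpace ℝ Y] {G : Set (X × Y)}
    (hG : IsClosed G) (hGc : Convex ℝ G) {R : ℝ} (hR : ∀ p ∈ G, ‖p.1‖ ≤ R) :
    interior (closure (Prod.snd '' G)) ⊆ Prod.snd '' G := by
  intro y hy
  obtain ⟨ρ, hρ, hball⟩ := Metric.nhds_basis_closedBall.mem_iff.1 (mem_interior_iff_mem_nhds.1 hy)
  have approx : ∀ q ∈ closedBall y ρ, ∃ p ∈ G, dist q p.2 < ρ / 2 := by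
    intro q hq
    obtain ⟨_, ⟨p, hp, rfl⟩, hpq⟩ := Metric.mem_closure_iff.1 (hball hq) (ρ / 2) (by positivity)
    exact ⟨p, hp, hpq⟩
  have step : ∀ (n : ℕ) (p : {p : X × Y // p ∈ G}), ∃ p' : {p : X × Y // p ∈ G},
      dist y p.1.2 ≤ ρ * (1 / 2) ^ n →
        dist y p'.1.2 ≤ ρ * (1 / 2) ^ (n + 1) ∧ dist p.1.1 p'.1.1 ≤ 2 * R * (1 / 2) ^ n := by
    rintro n ⟨⟨ξ, υ⟩, hp⟩
    by_cases hd : dist y υ ≤ ρ * (1 / 2) ^ n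
    swap
    · exact ⟨⟨(ξ, υ), hp⟩, fun h => absurd h hd⟩
    set t : ℝ := (1 / 2) ^ n with ht
    have ht0 : 0 < t := by positivity
    have ht1 : t ≤ 1 := pow_le_one₀ (by norm_num) (by norm_num)
    have hq : y + ((1 - t) / t) • (y - υ) ∈ closedBall y ρ := by
      rw [mem_closedBall, dist_eq_norm, add_sub_cancel_left, norm_smul, Real.norm_eq_abs,
        abs_of_nonneg (div_nonneg (by linarith) ht0.le), ← dist_eq_norm, div_mul_eq_mul_div,
        div_le_iff₀ ht0]
      nlinarith [dist_nonneg (x := y) (y := υ)]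
    obtain ⟨⟨x', a⟩, ha, hqa⟩ := approx _ hq
    refine ⟨⟨(1 - t) • (ξ, υ) + t • (x', a),
      hGc hp ha (by linarith) ht0.le (by ring)⟩, fun _ => ⟨?_, ?_⟩⟩
    · have : y - ((1 - t) • υ + t • a) = t • (y + ((1 - t) / t) • (y - υ) - a) := by
        rw [smul_sub, smul_add, smul_smul, mul_div_cancel₀ _ ht0.ne']
        module
      change dist y ((1 - t) • υ + t • a) ≤ _
      rw [dist_eq_norm, this, norm_smul, Real.norm_eq_abs, abs_of_pos ht0, ← dist_eq_norm, pow_succ,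
        ← ht]
      nlinarith
    · change dist ξ ((1 - t) • ξ + t • x') ≤ _
      have : ξ - ((1 - t) • ξ + t • x') = t • (ξ - x') := by module
      rw [dist_eq_norm, this, norm_smul, Real.norm_eq_abs, abs_of_pos ht0]
      have h1 := hR _ hp
      have h2 := hR _ ha
      have h3 := norm_sub_le ξ x'
      simp only at h1 h2
      nlinarith
  choose next hnext using step
  obtain ⟨p₀, hp₀, hd₀⟩ := approx y (mem_closedBall_self hρ.le)
  let u : ℕ → {p : X × Y // p ∈ G} := fun n => Nat.rec ⟨p₀, hp₀⟩ next n
  have hu : ∀ n, dist y (u n).1.2 ≤ ρ * (1 / 2) ^ n := by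
    intro n
    induction n with
    | zero =>
      change dist y p₀.2 ≤ _
      rw [pow_zero]
      linarith
    | succ n ih => exact (hnext n (u n) ih).1
  have hcauchy : CauchySeq fun n => (u n).1.1 :=
    cauchySeq_of_le_geometric (1 / 2) (2 * R) (by norm_num)
      fun n => (hnext n (u n) (hu n)).2
  obtain ⟨x, hx⟩ := cauchySeq_tendsto_of_complete hcauchy
  have hy' : Tendsto (fun n => (u n).1.2) atTop (𝓝 y) := by
    rw [tendsto_iff_dist_tendsto_zero]
    refine squeeze_zero (fun _ => dist_nonneg) (fun n => (dist_comm _ _).trans_le (hu n)) ?_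
    simpa using (tendsto_pow_atTop_nhds_zero_of_lt_one (r := (1 / 2 : ℝ))
      (by norm_num) (by norm_num)).const_mul ρ
  exact ⟨(x, y), hG.mem_of_tendsto (hx.prodMk_nhds hy')
    (Eventually.of_forall fun n => (u n).2), rfl⟩

/-- Robinson–Ursescu: an interior point of the second projection of a closed convex set is interior
to the second projection of a part of the set whose first projection is bounded. -/
theorem exists_mem_interior_image_snd_of_norm_le {X Y : Type*} [NormedAddCommGroup X]
    [NormedSpace ℝ X] [CompleteSpace X] [NormedAddCommGroup Y] [NormedSpace ℝ Y] [CompleteSpace Y]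
    {G : Set (X × Y)} (hG : IsClosed G) (hGc : Convex ℝ G) {y : Y}
    (hy : y ∈ interior (Prod.snd '' G)) :
    ∃ R : ℝ, 0 ≤ R ∧ y ∈ interior (Prod.snd '' (G ∩ {p | ‖p.1‖ ≤ R})) := by
  let A : ℕ → Set Y := fun n => Prod.snd '' (G ∩ {p | ‖p.1‖ ≤ n})
  have hclosed : ∀ n : ℕ, IsClosed (G ∩ {p : X × Y | ‖p.1‖ ≤ n}) := fun n =>
    hG.inter (isClosed_le continuous_fst.norm continuous_const)
  have hconvex : ∀ n : ℕ, Convex ℝ (G ∩ {p : X × Y | ‖p.1‖ ≤ n}) := fun n => by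
    refine hGc.inter ?_
    have := (convex_closedBall (0 : X) n).is_linear_preimage
      (LinearMap.fst ℝ X Y).isLinear
    simpa [preimage, mem_closedBall_zero_iff] using this
  have hAconv : ∀ n, Convex ℝ (A n) := fun n => (hconvex n).is_linear_image
    (LinearMap.snd ℝ X Y).isLinear
  have hAmono : Monotone A := fun m n hmn =>
    image_mono (inter_subset_inter_right _ fun p (hp : ‖p.1‖ ≤ m) =>
      hp.trans (Nat.cast_le.2 hmn))
  have hAmem : ∀ z ∈ Prod.snd '' G, ∃ n, z ∈ A n := by
    rintro _ ⟨p, hp, rfl⟩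
    obtain ⟨n, hn⟩ := exists_nat_ge ‖p.1‖
    exact ⟨n, p, ⟨hp, hn⟩, rfl⟩
  obtain ⟨n, q, hq⟩ : ∃ n, (interior (closure (A n))).Nonempty := by
    by_contra! hempty
    have hdense : Dense (⋂ n, (closure (A n))ᶜ) :=
      dense_iInter_of_isOpen_nat (fun n => isClosed_closure.isOpen_compl)
        fun n => interior_eq_empty_iff_dense_compl.1 (hempty n)
    obtain ⟨z, hz, hz'⟩ := hdense.inter_open_nonempty _ isOpen_interior ⟨y, hy⟩
    obtain ⟨n, hn⟩ := hAmem z (interior_subset hz)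
    exact mem_iInter.1 hz' n (subset_closure hn)
  have hqA : q ∈ interior (A n) := interior_maximal
    (interior_closure_image_snd_subset (hclosed n) (hconvex n) fun p hp => hp.2)
    isOpen_interior hq
  obtain ⟨s, hs, hs0⟩ : ∃ s : ℝ, y + s • (y - q) ∈ interior (Prod.snd '' G) ∧ 0 < s := by
    have hcont : Tendsto (fun s : ℝ => y + s • (y - q)) (𝓝[>] 0) (𝓝 y) := by
      have : Continuous fun s : ℝ => y + s • (y - q) := by fun_prop
      simpa using (this.tendsto 0).mono_left nhdsWithin_le_nhds
    exact ((hcont.eventually (isOpen_interior.mem_nhds hy)).and self_mem_nhdsWithin).exists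
  obtain ⟨m, hm⟩ := hAmem _ (interior_subset hs)
  refine ⟨(max m n : ℕ), by positivity, ?_⟩
  refine (hAconv (max m n)).openSegment_self_interior_subset_interior
    (hAmono (le_max_left m n) hm) (interior_mono (hAmono (le_max_right m n)) hqA) ?_
  refine ⟨1 / (1 + s), s / (1 + s), by positivity, by positivity, by field_simp, ?_⟩
  have h : (1 / (1 + s)) • (y + s • (y - q)) + (s / (1 + s)) • q
      = ((1 + s) / (1 + s)) • y := by
    module
  rw [h, div_self (by positivity), one_smul]

/-- A point of `C + cone B(ȳ, δ)` is reached from a point of the convex set `C` by a step in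
`cone B(ȳ, 2δ)` whose length is controlled by the distance to any prescribed point of `C`. -/
theorem Convex.exists_add_smul_eq_of_mem_add_coneB {Y : Type*} [NormedAddCommGroup Y]
    [NormedSpace ℝ Y] {C : Set Y} (hC : Convex ℝ C) {ybar y z : Y} {δ : ℝ} (hδ : 0 < δ)
    (hz : z ∈ C) (hy : y ∈ C + coneB ybar δ) :
    ∃ c ∈ C, ∃ r : ℝ, 0 ≤ r ∧ r ≤ ‖y - z‖ / δ ∧ ∃ w, ‖w - ybar‖ < 2 * δ ∧ y = c + r • w := by
  obtain ⟨v, hv, _, ⟨t, ht, w, hw, rfl⟩, rfl⟩ := hy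
  rw [mem_ball, dist_eq_norm] at hw
  simp only
  set e := ‖v + t • w - z‖ with he
  have he0 : 0 ≤ e := norm_nonneg _
  rcases le_or_gt t (e / δ) with hte | hte
  · exact ⟨v, hv, t, ht, hte, w, by linarith, rfl⟩
  rcases he0.eq_or_lt with h0 | he0
  · refine ⟨z, hz, 0, le_rfl, by positivity, w, by linarith, ?_⟩
    rw [zero_smul, add_zero]
    exact sub_eq_zero.1 (norm_eq_zero.1 h0.symm)
  set r := e / δ with hr
  have hr0 : 0 < r := by positivity
  have ht0 : 0 < t := hr0.trans hte
  have hs1 : r / t ≤ 1 := (div_le_one ht0).2 hte.le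
  have hs0 : 0 ≤ r / t := by positivity
  refine ⟨(1 - r / t) • z + (r / t) • v, hC hz hv (by linarith) hs0 (by ring), r, hr0.le, le_rfl,
    w + ((1 - r / t) / r) • (v + t • w - z), ?_, ?_⟩
  · have hstep : ‖((1 - r / t) / r) • (v + t • w - z)‖ ≤ δ := by
      rw [norm_smul, Real.norm_eq_abs, abs_of_nonneg (div_nonneg (by linarith) hr0.le), ← he,
        div_mul_eq_mul_div, div_le_iff₀ hr0, hr, mul_div_cancel₀ _ hδ.ne', ← hr]
      nlinarith
    calc ‖w + ((1 - r / t) / r) • (v + t • w - z) - ybar‖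
        = ‖(w - ybar) + ((1 - r / t) / r) • (v + t • w - z)‖ := by congr 1; abel
      _ ≤ ‖w - ybar‖ + ‖((1 - r / t) / r) • (v + t • w - z)‖ := norm_add_le _ _
      _ < 2 * δ := by linarith
  · have hrt : r • w = (r / t) • t • w := by rw [smul_smul, div_mul_cancel₀ _ ht0.ne']
    rw [smul_add r, smul_smul, mul_div_cancel₀ _ hr0.ne', hrt]
    module

theorem image_sub_right_mem_interior_iff {Y : Type*} [NormedAddCommGroup Y] {S : Set Y}
    {y₀ v : Y} : v ∈ interior ((fun v => v - y₀) '' S) ↔ y₀ + v ∈ interior S := by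
  have h := (Homeomorph.subRight y₀).image_interior S
  change (fun v => v - y₀) '' interior S = interior ((fun v => v - y₀) '' S) at h
  rw [← h]
  constructor
  · rintro ⟨w, hw, rfl⟩
    simpa using hw
  · exact fun hv => ⟨_, hv, add_sub_cancel_left _ _⟩

/-- Directional metric regularity makes a multiple of the direction interior to the shifted
range. -/
theorem DirMetRegMod.exists_smul_mem_interior {X Y : Type*} [PseudoMetricSpace X]
    [NormedAddCommGroup Y] [NormedSpace ℝ Y] {F : X → Set Y} {x₀ : X} {y₀ ybar : Y} {τ : ℝ}
    (h : DirMetRegMod F x₀ y₀ ybar τ) (h₀ : y₀ ∈ F x₀) :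
    ∃ l : ℝ, 0 ≤ l ∧ l • ybar ∈ interior ((fun v => v - y₀) '' (⋃ x, F x)) := by
  obtain ⟨ε, hε, δ, hδ, hreg⟩ := h
  set M := ‖ybar‖ + δ with hM
  have hM0 : 0 < M := by positivity
  have hl : 0 < ε / M := by positivity
  refine ⟨ε / M, hl.le, ?_⟩
  rw [mem_interior]
  refine ⟨(ε / M) • ball ybar δ, ?_, isOpen_ball.smul₀ hl.ne',
    smul_mem_smul_set (mem_ball_self hδ)⟩
  rintro _ ⟨w, hw, rfl⟩
  have hwM : ‖w‖ < M := by
    have h1 := norm_sub_norm_le w ybar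
    rw [mem_ball, dist_eq_norm] at hw
    linarith
  have hdist : ‖(ε / M) • w‖ < ε := by
    rw [norm_smul, Real.norm_eq_abs, abs_of_pos hl, div_mul_eq_mul_div, div_lt_iff₀ hM0]
    exact mul_lt_mul_of_pos_left hwM hε
  have hinf : Metric.infEDist (y₀ + (ε / M) • w) (F x₀) < ENNReal.ofReal ε := by
    refine (Metric.infEDist_le_edist_of_mem h₀).trans_lt ?_
    rw [edist_dist, dist_eq_norm, add_sub_cancel_left]
    exact (ENNReal.ofReal_lt_ofReal_iff hε).2 hdist
  have key := hreg x₀ (y₀ + (ε / M) • w) (mem_ball_self hε)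
    (by rwa [mem_ball, dist_eq_norm, add_sub_cancel_left]) hinf
    (add_mem_add h₀ ⟨ε / M, hl.le, w, hw, rfl⟩)
  have hfin : Metric.infEDist x₀ {u | y₀ + (ε / M) • w ∈ F u} ≠ ⊤ :=
    (key.trans_lt (ENNReal.mul_lt_top ENNReal.ofReal_lt_top
      (hinf.trans ENNReal.ofReal_lt_top))).ne
  obtain ⟨u, hu⟩ : {u | y₀ + (ε / M) • w ∈ F u}.Nonempty := by
    rw [nonempty_iff_ne_empty]
    intro hempty
    exact hfin (by rw [hempty, Metric.infEDist_empty])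
  exact ⟨_, mem_iUnion.2 ⟨u, hu⟩, add_sub_cancel_left _ _⟩

/-- A closed convex multifunction between Banach spaces is directionally metrically regular in a
direction one of whose positive multiples is interior to the shifted range. -/
theorem exists_dirMetRegMod_of_mem_interior {X Y : Type*} [NormedAddCommGroup X] [NormedSpace ℝ X]
    [CompleteSpace X] [NormedAddCommGroup Y] [NormedSpace ℝ Y] [CompleteSpace Y] {F : X → Set Y}
    (hclosed : IsClosed {p : X × Y | p.2 ∈ F p.1}) (hconv : Convex ℝ {p : X × Y | p.2 ∈ F p.1})
    (x₀ : X) {y₀ ybar : Y} {l : ℝ} (hl : 0 < l) (hint : y₀ + l • ybar ∈ interior (⋃ x, F x)) :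
    ∃ τ > 0, DirMetRegMod F x₀ y₀ ybar τ := by
  have hrange : Prod.snd '' {p : X × Y | p.2 ∈ F p.1} = ⋃ x, F x := by
    ext v
    simp
  rw [← hrange] at hint
  obtain ⟨R, hR, hintR⟩ := exists_mem_interior_image_snd_of_norm_le hclosed hconv hint
  obtain ⟨η, hη, hball⟩ := Metric.mem_nhds_iff.1 (mem_interior_iff_mem_nhds.1 hintR)
  have hFclosed : ∀ x, IsClosed (F x) := fun x =>
    hclosed.preimage (f := fun y => (x, y)) (by fun_prop)
  have hFconv : ∀ x, Convex ℝ (F x) := fun x a ha b hb s t hs ht hst => by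
    have := hconv (x := (x, a)) ha (y := (x, b)) hb hs ht hst
    simpa [← add_smul, hst] using this
  set δ := η / (4 * l) with hδdef
  have hδ : 0 < δ := by positivity
  have hlδ : l * (2 * δ) = η / 2 := by
    rw [hδdef]
    field_simp
    norm_num
  set B := 2 / δ * (‖ybar‖ + 2 * δ) + 1 with hB
  have hB0 : 0 < B := by positivity
  set K := R + ‖x₀‖ + 1 with hK
  have hK0 : 0 < K := by positivity
  obtain ⟨ε, hε, hε1, hεB, hεl⟩ : ∃ ε > 0, ε ≤ 1 ∧ ε * B ≤ η / 2 ∧ 2 * ε / δ ≤ l := by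
    refine ⟨min 1 (min (η / 2 / B) (l * δ / 2)), by positivity, min_le_left _ _, ?_, ?_⟩
    · rw [← le_div_iff₀ hB0]
      exact (min_le_right _ _).trans (min_le_left _ _)
    · rw [div_le_iff₀ hδ]
      linarith [(min_le_right 1 (min (η / 2 / B) (l * δ / 2))).trans (min_le_right _ _)]
  refine ⟨2 * K / (δ * l), by positivity, ε, hε, δ, hδ, fun x y hx hy hd hcone => ?_⟩
  change Metric.infEDist y (F x) < _ at hd
  change Metric.infEDist x {u | y ∈ F u} ≤ _ * Metric.infEDist y (F x)
  by_cases hyF : y ∈ F x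
  · rw [Metric.infEDist_zero_of_mem (s := {u | y ∈ F u}) hyF]
    exact zero_le
  have hne : (F x).Nonempty := by
    obtain ⟨v, hv, -⟩ := hcone
    exact ⟨v, hv⟩
  set D := Metric.infDist y (F x) with hD
  have hD0 : 0 < D := ((hFclosed x).notMem_iff_infDist_pos hne).1 hyF
  have hDe : Metric.infEDist y (F x) = ENNReal.ofReal D :=
    (ENNReal.ofReal_toReal (Metric.infEDist_ne_top hne)).symm
  rw [hDe, ENNReal.ofReal_lt_ofReal_iff hε] at hd
  obtain ⟨z, hz, hyz⟩ := (Metric.infDist_lt_iff hne).1 (show D < 2 * D by linarith)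
  obtain ⟨c, hc, r, hr0, hr, w, hw, rfl⟩ :=
    (hFconv x).exists_add_smul_eq_of_mem_add_coneB hδ hz hcone
  have hrD : r ≤ 2 * D / δ :=
    hr.trans (div_le_div_of_nonneg_right (by rw [← dist_eq_norm]; exact hyz.le) hδ.le)
  have hrε : r ≤ 2 * ε / δ := hrD.trans (by gcongr)
  have hwn : ‖w‖ ≤ ‖ybar‖ + 2 * δ := by linarith [norm_sub_norm_le w ybar]
  have htarget : c + l • w ∈ ball (y₀ + l • ybar) η := by
    rw [mem_ball, dist_eq_norm] at hy ⊢
    have h1 : ‖r • w‖ ≤ 2 * ε / δ * (‖ybar‖ + 2 * δ) := by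
      rw [norm_smul, Real.norm_eq_abs, abs_of_nonneg hr0]
      gcongr
    have h2 : ‖l • (w - ybar)‖ < η / 2 := by
      rw [norm_smul, Real.norm_eq_abs, abs_of_pos hl, ← hlδ]
      gcongr
    have h3 : 2 * ε / δ * (‖ybar‖ + 2 * δ) + ε = ε * B := by
      rw [hB]
      ring
    calc ‖c + l • w - (y₀ + l • ybar)‖
        = ‖(c + r • w - y₀) - r • w + l • (w - ybar)‖ := by congr 1; module
      _ ≤ ‖c + r • w - y₀‖ + ‖r • w‖ + ‖l • (w - ybar)‖ :=
        (norm_add_le _ _).trans (by gcongr; exact norm_sub_le _ _)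
      _ < η := by linarith
  obtain ⟨⟨x', q⟩, ⟨hq, hx'⟩, hqeq⟩ := hball htarget
  simp only [mem_ofPred_eq] at hq hx' hqeq
  subst hqeq
  have hrl : r / l ≤ 1 := (div_le_one hl).2 (hrε.trans hεl)
  have hrl0 : 0 ≤ r / l := by positivity
  have hmem : c + r • w ∈ F ((1 - r / l) • x + (r / l) • x') := by
    have := hconv (x := (x, c)) hc (y := (x', c + l • w)) hq (sub_nonneg.2 hrl) hrl0 (by ring)
    change (1 - r / l) • c + (r / l) • (c + l • w) ∈ F ((1 - r / l) • x + (r / l) • x') at this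
    rw [smul_add, smul_smul, div_mul_cancel₀ _ hl.ne', ← add_assoc, ← add_smul] at this
    simpa using this
  refine (Metric.infEDist_le_edist_of_mem (s := {u | c + r • w ∈ F u}) hmem).trans ?_
  rw [hDe, ← ENNReal.ofReal_mul (by positivity), edist_dist]
  refine ENNReal.ofReal_le_ofReal ?_
  have hxx' : ‖x - x'‖ ≤ K := by
    rw [mem_ball, dist_eq_norm] at hx
    linarith [norm_sub_le x x', norm_sub_norm_le x x₀]
  have hsub : x - ((1 - r / l) • x + (r / l) • x') = (r / l) • (x - x') := by module
  rw [dist_eq_norm, hsub, norm_smul, Real.norm_eq_abs, abs_of_nonneg hrl0]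
  calc r / l * ‖x - x'‖ ≤ 2 * D / δ / l * K := by gcongr
    _ = 2 * K / (δ * l) * D := by field_simp

/-- Corollary: directional regularity of closed convex
multifunctions: if `gph F` is closed and convex and `x₀ ∈ Int (Dom F)`, then `F` is
directionally metrically regular at `(x₀,y₀)` in the direction `ybar` iff
`cone{ybar} ∩ Int(F(X) − y₀) ≠ ∅`. -/
theorem stmt13 {X Y : Type*} [NormedAddCommGroup X] [NormedSpace ℝ X] [CompleteSpace X]
    [NormedAddCommGroup Y] [NormedSpace ℝ Y] [CompleteSpace Y]
    (F : X → Set Y) (hclosed : IsClosed {p : X × Y | p.2 ∈ F p.1})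
    (hconv : Convex ℝ {p : X × Y | p.2 ∈ F p.1})
    (x₀ : X) (y₀ : Y) (h₀ : y₀ ∈ F x₀) (ybar : Y)
    (hdom : x₀ ∈ interior {x | (F x).Nonempty}) :
    (∃ τ > 0, DirMetRegMod F x₀ y₀ ybar τ) ↔
      ∃ l : ℝ, 0 ≤ l ∧ l • ybar ∈ interior ((fun v => v - y₀) '' (⋃ x, F x)) := by
  refine ⟨fun ⟨_, _, h⟩ => h.exists_smul_mem_interior h₀, fun ⟨l, hl, hint⟩ => ?_⟩
  rw [image_sub_right_mem_interior_iff] at hint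
  have hcont : Tendsto (fun s : ℝ => y₀ + s • ybar) (𝓝[>] l) (𝓝 (y₀ + l • ybar)) :=
    ((by fun_prop : Continuous fun s : ℝ => y₀ + s • ybar).tendsto l).mono_left nhdsWithin_le_nhds
  obtain ⟨l', hint', hl'⟩ :=
    ((hcont.eventually (isOpen_interior.mem_nhds hint)).and self_mem_nhdsWithin).exists
  exact exists_dirMetRegMod_of_mem_interior hclosed hconv x₀ (hl.trans_lt hl') hint'
end

section
/- Let X, Y be Banach spaces and let F : X ⇉ Y be a multifunction, (x₀,y₀) ∈ gph F and ȳ ∈ Y. If F is directionally metrically regular at (x₀,y₀) in the direction ȳ, then cone{ȳ} ∩ Int(F(X) − y₀) ≠ ∅, where F(X) = ∪_{x ∈ X} F(x) and cone{ȳ} = {λȳ : λ ≥ 0}. -/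
open Metric Set Filter Topology
open scoped ENNReal NNReal Pointwise

/-- necessity part: if `F` is directionally metrically regular at
`(x₀,y₀)` in the direction `ybar`, then `cone{ybar} ∩ Int(F(X) − y₀) ≠ ∅`. -/
theorem stmt14 {X Y : Type*} [NormedAddCommGroup X] [NormedSpace ℝ X] [CompleteSpace X]
    [NormedAddCommGroup Y] [NormedSpace ℝ Y] [CompleteSpace Y]
    (F : X → Set Y) (x₀ : X) (y₀ : Y) (h₀ : y₀ ∈ F x₀) (ybar : Y)
    (hreg : ∃ τ > 0, DirMetRegMod F x₀ y₀ ybar τ) :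
    ∃ l : ℝ, 0 ≤ l ∧ l • ybar ∈ interior ((fun v => v - y₀) '' (⋃ x, F x)) := by
  obtain ⟨τ, -, ε, hε, δ, hδ, h⟩ := hreg
  have hM : 0 < ‖ybar‖ + δ := by positivity
  let l : ℝ := ε / (‖ybar‖ + δ)
  have hl0 : 0 < l := by positivity
  refine ⟨l, hl0.le, mem_interior.2 ⟨l • ball ybar δ, ?_, isOpen_ball.smul₀ hl0.ne',
    smul_mem_smul_set (mem_ball_self hδ)⟩⟩
  rintro _ ⟨w, hw, rfl⟩
  have hwM : ‖w‖ < ‖ybar‖ + δ := by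
    have := norm_le_norm_add_norm_sub' w ybar
    rw [mem_ball, dist_eq_norm] at hw
    linarith
  have hdist : dist (y₀ + l • w) y₀ < ε := by
    rw [dist_eq_norm, add_sub_cancel_left, norm_smul, Real.norm_of_nonneg hl0.le]
    calc l * ‖w‖ < l * (‖ybar‖ + δ) := by gcongr
      _ = ε := div_mul_cancel₀ _ hM.ne'
  have hinf : infEDist (y₀ + l • w) (F x₀) < ENNReal.ofReal ε := by
    refine (infEDist_le_edist_of_mem h₀).trans_lt ?_
    rw [edist_dist]
    exact (ENNReal.ofReal_lt_ofReal_iff hε).2 hdist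
  have hle := h x₀ (y₀ + l • w) (mem_ball_self hε) hdist hinf
    (add_mem_add h₀ ⟨l, hl0.le, w, hw, rfl⟩)
  have hne : {u | y₀ + l • w ∈ F u}.Nonempty := by
    rw [nonempty_iff_ne_empty]
    intro he
    rw [he] at hle
    exact absurd (infEDist_empty.symm.trans_le hle) (not_le.2
      (ENNReal.mul_lt_top ENNReal.ofReal_lt_top (hinf.trans ENNReal.ofReal_lt_top)))
  obtain ⟨u, hu⟩ := hne
  exact ⟨y₀ + l • w, mem_iUnion.2 ⟨u, hu⟩, add_sub_cancel_left _ _⟩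
end

section
/- Let X, Y be Banach spaces, let F : X ⇉ Y be a multifunction whose graph is closed and convex, let x₀ ∈ X, y₀ ∈ F(x₀), ȳ ∈ Y and λ ≥ 0. If 0 ∈ Int(F(X) − y₀ − λȳ), where F(X) = ∪_{x∈X} F(x), then there exist γ > 0 and β > 0 such that B(λȳ, γ) ⊆ cl(F(B(x₀,β)) − y₀), where F(B(x₀,β)) = ∪_{x ∈ B(x₀,β)} F(x). -/
open Metric Set Filter Topology
open scoped ENNReal NNReal Pointwise

/-- The image of a convex set under a multifunction with convex graph is convex. -/
theorem convex_biUnion_of_convex_graph {X Y : Type*} [AddCommGroup X] [Module ℝ X]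
    [AddCommGroup Y] [Module ℝ Y] {F : X → Set Y}
    (hF : Convex ℝ {p : X × Y | p.2 ∈ F p.1}) {s : Set X} (hs : Convex ℝ s) :
    Convex ℝ (⋃ x ∈ s, F x) := by
  intro u hu v hv a b ha hb hab
  simp only [mem_iUnion, exists_prop] at hu hv ⊢
  obtain ⟨x, hx, hxu⟩ := hu
  obtain ⟨y, hy, hyv⟩ := hv
  exact ⟨a • x + b • y, hs hx hy ha hb hab,
    hF (x := (x, u)) hxu (y := (y, v)) hyv ha hb hab⟩

/-- If an increasing sequence of convex sets covers a neighborhood of a point of a Banach space,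
then that point is interior to the closure of one of them. -/
theorem exists_mem_interior_closure_of_convex {Y : Type*} [NormedAddCommGroup Y]
    [NormedSpace ℝ Y] [CompleteSpace Y] {A : ℕ → Set Y} (hA : ∀ n, Convex ℝ (A n))
    (hmono : Monotone A) {p : Y} (hp : ⋃ n, A n ∈ 𝓝 p) :
    ∃ n, p ∈ interior (closure (A n)) := by
  obtain ⟨r, hr, hsub⟩ := Metric.mem_nhds_iff.1 hp
  have hdense : Dense (⋃ n, interior (closure (A n) ∪ (ball p r)ᶜ)) := by
    refine dense_iUnion_interior_of_closed
      (fun n => isClosed_closure.union isOpen_ball.isClosed_compl) ?_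
    refine eq_univ_of_forall fun y => ?_
    by_cases hy : y ∈ ball p r
    · obtain ⟨n, hn⟩ := mem_iUnion.1 (hsub hy)
      exact mem_iUnion.2 ⟨n, Or.inl (subset_closure hn)⟩
    · exact mem_iUnion.2 ⟨0, Or.inr hy⟩
  obtain ⟨z, hzb, hz⟩ := hdense.inter_open_nonempty _ isOpen_ball ⟨p, mem_ball_self hr⟩
  obtain ⟨n, hn⟩ := mem_iUnion.1 hz
  have hzn : z ∈ interior (closure (A n)) := by
    refine mem_interior.2 ⟨_, ?_, isOpen_interior.inter isOpen_ball, hn, hzb⟩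
    rintro y ⟨hy, hyb⟩
    exact (interior_subset hy).resolve_right fun h => h hyb
  have hw : (2 : ℝ) • p - z ∈ ball p r := by
    have h : (2 : ℝ) • p - z - p = p - z := by module
    rwa [mem_ball, dist_eq_norm, h, ← dist_eq_norm, dist_comm]
  obtain ⟨m, hm⟩ := mem_iUnion.1 (hsub hw)
  have hzN := interior_mono (closure_mono (hmono (le_max_left n m))) hzn
  have hwN := subset_closure (hmono (le_max_right n m) hm)
  refine ⟨max n m, ?_⟩
  have hmid := (hA (max n m)).closure.combo_interior_self_mem_interior hzN hwN
    (a := 1 / 2) (b := 1 / 2) (by norm_num) (by norm_num) (by norm_num)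
  convert hmid using 1
  module

/-- Baire category argument for convex multifunctions: if `gph F` is
closed and convex, `y₀ ∈ F(x₀)`, `l ≥ 0` and `0 ∈ Int(F(X) − y₀ − l•ybar)`, then there
are `γ, β > 0` with `B(l•ybar, γ) ⊆ cl(F(B(x₀,β)) − y₀)`. -/
theorem stmt15 {X Y : Type*} [NormedAddCommGroup X] [NormedSpace ℝ X] [CompleteSpace X]
    [NormedAddCommGroup Y] [NormedSpace ℝ Y] [CompleteSpace Y]
    (F : X → Set Y) (hclosed : IsClosed {p : X × Y | p.2 ∈ F p.1})
    (hconv : Convex ℝ {p : X × Y | p.2 ∈ F p.1})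
    (x₀ : X) (y₀ : Y) (h₀ : y₀ ∈ F x₀) (ybar : Y) (l : ℝ) (hl : 0 ≤ l)
    (hint : (0 : Y) ∈ interior ((fun v => v - y₀ - l • ybar) '' (⋃ x, F x))) :
    ∃ γ > 0, ∃ β > 0, Metric.ball (l • ybar) γ ⊆
      closure ((fun v => v - y₀) '' (⋃ x ∈ Metric.ball x₀ β, F x)) := by
  set A : ℕ → Set Y := fun n => ⋃ x ∈ ball x₀ (n : ℝ), F x
  have hmono : Monotone A := fun m n hmn =>
    biUnion_subset_biUnion_left (ball_subset_ball (by exact_mod_cast hmn))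
  have hcover : ⋃ x, F x ⊆ ⋃ n, A n := by
    refine iUnion_subset fun x y hy => ?_
    obtain ⟨n, hn⟩ := exists_nat_gt (dist x x₀)
    exact mem_iUnion.2 ⟨n, mem_biUnion (mem_ball.2 hn) hy⟩
  have hnhds : ⋃ n, A n ∈ 𝓝 (y₀ + l • ybar) := by
    have hcont : Tendsto (fun v : Y => v - y₀ - l • ybar) (𝓝 (y₀ + l • ybar)) (𝓝 0) :=
      Continuous.tendsto' (by fun_prop) _ _ (by abel)
    filter_upwards [hcont (mem_interior_iff_mem_nhds.1 hint)] with v hv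
    obtain ⟨u, hu, huv⟩ := hv
    have : u = v := by simpa using huv
    exact hcover (this ▸ hu)
  obtain ⟨n, hn⟩ := exists_mem_interior_closure_of_convex
    (fun n => convex_biUnion_of_convex_graph hconv (convex_ball x₀ (n : ℝ))) hmono hnhds
  obtain ⟨γ, hγ, hsub⟩ := Metric.mem_nhds_iff.1 (mem_interior_iff_mem_nhds.1 hn)
  refine ⟨γ, hγ, n + 1, by positivity, fun v hv => ?_⟩
  have hv' : y₀ + v ∈ closure (⋃ x ∈ ball x₀ ((n : ℝ) + 1), F x) := by
    refine closure_mono (biUnion_subset_biUnion_left (ball_subset_ball (by linarith))) (hsub ?_)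
    rwa [mem_ball, dist_add_left]
  have hcont : Continuous fun v : Y => v - y₀ := by fun_prop
  simpa using image_closure_subset_closure_image hcont (mem_image_of_mem _ hv')
end

section
/- Let X be a normed space, Y a Banach space, A : X → Y a continuous linear map, K ⊆ Y a nonempty closed convex set, k₀ ∈ K, ȳ ∈ Y and λ ≥ 0. If 0 ∈ Int(k₀ + Im A − K − λȳ), where Im A is the range of A, then there exist γ > 0 and β > 0 such that B(λȳ, γ) ⊆ cl( A(B(0,β)) + k₀ − K ). -/
open Metric Set Filter Topology
open scoped ENNReal NNReal Pointwise

/-- If an increasing sequence of convex sets covers a ball of a Banach space, then the closure of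
one of them is a neighbourhood of the centre of the ball. -/
theorem exists_mem_interior_closure_of_ball_subset_iUnion {Y : Type*} [NormedAddCommGroup Y]
    [NormedSpace ℝ Y] [CompleteSpace Y] {C : ℕ → Set Y} (hmono : Monotone C)
    (hconv : ∀ n, Convex ℝ (C n)) {z : Y} {r : ℝ} (hr : 0 < r) (hC : ball z r ⊆ ⋃ n, C n) :
    ∃ n, z ∈ interior (closure (C n)) := by
  have hdense : Dense (⋃ n, interior (closure (C n) ∪ (ball z r)ᶜ)) := by
    refine dense_iUnion_interior_of_closed
      (fun n => isClosed_closure.union isOpen_ball.isClosed_compl) ?_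
    refine eq_univ_of_forall fun y => ?_
    by_cases hy : y ∈ ball z r
    · obtain ⟨n, hn⟩ := mem_iUnion.1 (hC hy)
      exact mem_iUnion.2 ⟨n, Or.inl (subset_closure hn)⟩
    · exact mem_iUnion.2 ⟨0, Or.inr hy⟩
  obtain ⟨w, hwU, hw⟩ := hdense.inter_open_nonempty _ isOpen_ball ⟨z, mem_ball_self hr⟩
  obtain ⟨n, hn⟩ := mem_iUnion.1 hw
  have hwn : w ∈ interior (closure (C n)) := by
    refine mem_interior.2 ⟨ball z r ∩ interior (closure (C n) ∪ (ball z r)ᶜ), ?_,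
      isOpen_ball.inter isOpen_interior, hwU, hn⟩
    rintro y ⟨hy, hy'⟩
    exact (interior_subset hy').resolve_right (not_not_intro hy)
  have hz' : (2 : ℝ) • z - w ∈ ball z r := by
    rw [mem_ball, dist_eq_norm] at hwU ⊢
    rwa [show (2 : ℝ) • z - w - z = -(w - z) by module, norm_neg]
  obtain ⟨m, hm⟩ := mem_iUnion.1 (hC hz')
  refine ⟨max n m, ?_⟩
  have h := (hconv (max n m)).closure.combo_interior_self_mem_interior
    (interior_mono (closure_mono (hmono (le_max_left n m))) hwn)
    (subset_closure (hmono (le_max_right n m) hm))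
    (a := 1 / 2) (b := 1 / 2) (by norm_num) (by norm_num) (by norm_num)
  rwa [show (1 / 2 : ℝ) • w + (1 / 2 : ℝ) • ((2 : ℝ) • z - w) = z by module] at h

/-- Baire category argument, linear case: for a continuous linear map
`A : X → Y` with `Y` Banach, a nonempty closed convex set `K ⊆ Y`, `k₀ ∈ K`, `l ≥ 0`,
if `0 ∈ Int(k₀ + Im A − K − l•ybar)` then there are `γ, β > 0` with
`B(l•ybar, γ) ⊆ cl(A(B(0,β)) + k₀ − K)`. -/
theorem stmt16 {X Y : Type*} [NormedAddCommGroup X] [NormedSpace ℝ X]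
    [NormedAddCommGroup Y] [NormedSpace ℝ Y] [CompleteSpace Y]
    (A : X →L[ℝ] Y) (K : Set Y) (hne : K.Nonempty) (hKc : IsClosed K)
    (hKconv : Convex ℝ K) (k₀ : Y) (hk₀ : k₀ ∈ K) (ybar : Y) (l : ℝ) (hl : 0 ≤ l)
    (hint : (0 : Y) ∈ interior {v | ∃ x : X, ∃ k ∈ K, v = k₀ + A x - k - l • ybar}) :
    ∃ γ > 0, ∃ β > 0, Metric.ball (l • ybar) γ ⊆
      closure {v | ∃ x : X, ‖x‖ < β ∧ ∃ k ∈ K, v = A x + k₀ - k} := by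
  let C : ℕ → Set Y := fun n => {v | ∃ x : X, ‖x‖ < (n : ℝ) + 1 ∧ ∃ k ∈ K, v = A x + k₀ - k}
  have hmono : Monotone C := by
    rintro m n hmn v ⟨x, hx, hv⟩
    exact ⟨x, hx.trans_le (by gcongr), hv⟩
  have hconv : ∀ n, Convex ℝ (C n) := by
    rintro n _ ⟨x, hx, k, hk, rfl⟩ _ ⟨x', hx', k', hk', rfl⟩ a b ha hb hab
    refine ⟨a • x + b • x', ?_, a • k + b • k', hKconv hk hk' ha hb hab, ?_⟩
    · have := convex_ball (0 : X) ((n : ℝ) + 1) (mem_ball_zero_iff.2 hx)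
        (mem_ball_zero_iff.2 hx') ha hb hab
      exact mem_ball_zero_iff.1 this
    · obtain rfl : b = 1 - a := by linarith
      simp only [map_add, map_smul]
      module
  obtain ⟨r, hr, hball⟩ := Metric.isOpen_iff.1 isOpen_interior _ hint
  have hC : ball (l • ybar) r ⊆ ⋃ n, C n := by
    intro y hy
    have hy' : y - l • ybar ∈ ball (0 : Y) r := by
      rwa [mem_ball_zero_iff, ← dist_eq_norm]
    obtain ⟨x, k, hk, hv⟩ := interior_subset (hball hy')
    obtain ⟨n, hn⟩ := exists_nat_ge ‖x‖
    refine mem_iUnion.2 ⟨n, x, by linarith, k, hk, ?_⟩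
    rw [sub_left_inj] at hv
    rw [hv, add_comm k₀]
  obtain ⟨n, hn⟩ := exists_mem_interior_closure_of_ball_subset_iUnion hmono hconv hr hC
  obtain ⟨γ, hγ, hsub⟩ := Metric.isOpen_iff.1 isOpen_interior _ hn
  exact ⟨γ, hγ, (n : ℝ) + 1, by positivity, hsub.trans interior_subset⟩
end

section
/- Let X be a complete metric space and Y a normed linear space. Let F : X ⇉ Y be a closed multifunction, (x₀,y₀) ∈ gph F and ȳ ∈ Y. Suppose there exist τ > 0, ε > 0, δ > 0 such that d(x, F⁻¹(y)) ≤ τ d(y, F(x)) for all (x,y) ∈ B((x₀,y₀), ε) with y ∈ F(x) + cone B(ȳ,δ) and d(y, F(x)) < ε. Let α ∈ (0,1), set γ := α‖ȳ‖/(‖ȳ‖ + δ(1−α)), and let L > 0 satisfy L < δ(1−α)α/(τ((1+α)‖ȳ‖ + δ(1−α))). Then for every mapping g : X → Y that is Lipschitz with constant L on a neighborhood of x₀, the multifunction F + g (defined by (F+g)(x) = F(x) + g(x)) is directionally metrically regular at (x₀, y₀ + g(x₀)) in the direction ȳ, with modulus at most ((1−γ)/(τ(1+γ)) − L)⁻¹.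 -/
open Metric Set Filter Topology
open scoped ENNReal NNReal Pointwise

/-- A shift by `c` can be moved from the set to the point in `infEDist`. -/
lemma infEDist_add_singleton {Y : Type*} [SeminormedAddCommGroup Y] (A : Set Y) (y c : Y) :
    infEDist y (A + {c}) = infEDist (y - c) A := by
  have h := infEDist_image (x := y - c) (t := A) (isometry_add_right c)
  rw [sub_add_cancel] at h
  rw [Set.add_singleton]
  exact h

/-- Membership in a cone: a small perturbation of a positive multiple of the axis. -/
lemma smul_add_mem_coneB {Y : Type*} [SeminormedAddCommGroup Y] [NormedSpace ℝ Y] {ybar p : Y}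
    {t δ : ℝ} (ht : 0 < t) (hp : ‖p‖ < t * δ) : t • ybar + p ∈ coneB ybar δ := by
  refine ⟨t, ht.le, ybar + t⁻¹ • p, ?_, ?_⟩
  · rw [mem_ball_iff_norm, add_sub_cancel_left, norm_smul, norm_inv, Real.norm_of_nonneg ht.le,
      inv_mul_lt_iff₀ ht]
    exact hp
  · rw [smul_add, smul_smul, mul_inv_cancel₀ ht.ne', one_smul]

/-- An element of a narrow cone which is not too small stays in a wider cone after subtracting a
small multiple of the axis. -/
lemma sub_smul_mem_coneB {Y : Type*} [SeminormedAddCommGroup Y] [NormedSpace ℝ Y] {ybar k : Y}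
    {δ α r : ℝ} (hδ : 0 < δ) (hα0 : 0 < α) (hα1 : α < 1) (hr : 0 < r)
    (hk : k ∈ coneB ybar (δ * (1 - α))) (hrk : r ≤ ‖k‖) :
    k - (α * r / (‖ybar‖ + δ * (1 - α))) • ybar ∈ coneB ybar δ := by
  obtain ⟨l, hl, w, hw, rfl⟩ := hk
  have hδ' : 0 < δ * (1 - α) := mul_pos hδ (by linarith)
  have hD : 0 < ‖ybar‖ + δ * (1 - α) := by positivity
  rw [mem_ball_iff_norm] at hw
  rw [norm_smul, Real.norm_of_nonneg hl] at hrk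
  have hl0 : 0 < l := by
    rcases hl.eq_or_lt with h | h
    · rw [← h] at hrk; linarith
    · exact h
  have hwn : ‖w‖ ≤ ‖ybar‖ + δ * (1 - α) := by
    have := norm_le_norm_add_norm_sub' w ybar
    linarith
  set t := α * r / (‖ybar‖ + δ * (1 - α)) with ht
  have htl : t ≤ α * l := by
    rw [ht, div_le_iff₀ hD, mul_assoc]
    exact mul_le_mul_of_nonneg_left (hrk.trans (mul_le_mul_of_nonneg_left hwn hl)) hα0.le
  have hlt : l * (1 - α) ≤ l - t := by linarith
  have hpos : 0 < l - t := lt_of_lt_of_le (mul_pos hl0 (by linarith)) hlt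
  have heq : l • w - t • ybar = (l - t) • ybar + l • (w - ybar) := by module
  rw [heq]
  refine smul_add_mem_coneB hpos ?_
  rw [norm_smul, Real.norm_of_nonneg hl]
  calc l * ‖w - ybar‖ < l * (δ * (1 - α)) := by gcongr
    _ = l * (1 - α) * δ := by ring
    _ ≤ (l - t) * δ := by gcongr

/-- Picard-type iteration for a residual function `φ`: if from every point of `S` close to `a` one
can reach another point of `S` with a residual reduced by a fixed factor, at a cost controlled by
the decrease of `φ`, then points of `S` with vanishing residual accumulate near the starting
point. -/
lemma exists_tendsto_of_residual_decrease {X : Type*} [PseudoMetricSpace X] [CompleteSpace X]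
    {S : Set X} {φ : X → ℝ} {a : X} {c q ρ : ℝ} (hφ : ∀ x, 0 ≤ φ x) (hc : 0 ≤ c) (hq0 : 0 ≤ q)
    (hq1 : q < 1)
    (hstep : ∀ x ∈ S, dist x a + c * φ x < ρ →
      ∃ u ∈ S, dist x u ≤ c * (φ x - φ u) ∧ φ u ≤ q * φ x)
    {x : X} (hx : x ∈ S) (hxa : dist x a + c * φ x < ρ) :
    ∃ (s : ℕ → X) (l : X), (∀ n, s n ∈ S) ∧ Tendsto s atTop (𝓝 l) ∧
      Tendsto (fun n => φ (s n)) atTop (𝓝 0) ∧ dist x l ≤ c * φ x ∧ dist l a < ρ := by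
  have key : ∀ z : {z // z ∈ S ∧ dist z a + c * φ z < ρ},
      ∃ u : {z // z ∈ S ∧ dist z a + c * φ z < ρ},
        dist (z : X) u ≤ c * (φ z - φ u) ∧ φ u ≤ q * φ z := by
    rintro ⟨z, hz, hza⟩
    obtain ⟨u, hu, h1, h2⟩ := hstep z hz hza
    refine ⟨⟨u, hu, ?_⟩, h1, h2⟩
    have := dist_triangle_left u a z
    linarith
  choose f hf1 hf2 using key
  let s : ℕ → {z // z ∈ S ∧ dist z a + c * φ z < ρ} := fun n => f^[n] ⟨x, hx, hxa⟩
  have hs : ∀ n, s (n + 1) = f (s n) := fun n => Function.iterate_succ_apply' f n _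
  have hgeo : ∀ n, φ (s n) ≤ φ x * q ^ n := by
    intro n
    induction n with
    | zero => simp [s]
    | succ n ih =>
      rw [hs]
      calc φ (f (s n)) ≤ q * φ (s n) := hf2 _
        _ ≤ q * (φ x * q ^ n) := by gcongr
        _ = φ x * q ^ (n + 1) := by ring
  have hdist : ∀ n, dist (s n : X) (s (n + 1)) ≤ c * φ x * q ^ n := by
    intro n
    rw [hs]
    calc dist (s n : X) (f (s n)) ≤ c * (φ (s n) - φ (f (s n))) := hf1 _
      _ ≤ c * (φ x * q ^ n) := by
        gcongr
        linarith [hgeo n, hφ (f (s n))]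
      _ = c * φ x * q ^ n := by ring
  obtain ⟨l, hl⟩ := cauchySeq_tendsto_of_complete (cauchySeq_of_le_geometric q _ hq1 hdist)
  have hxn : ∀ n, dist x (s n) ≤ c * (φ x - φ (s n)) := by
    intro n
    induction n with
    | zero => simp [s]
    | succ n ih =>
      have h1 := dist_triangle x (s n : X) (s (n + 1))
      have h2 := hf1 (s n)
      rw [← hs] at h2
      linarith
  have hxl : dist x l ≤ c * φ x := by
    refine le_of_tendsto (tendsto_const_nhds.dist hl) (Eventually.of_forall fun n => ?_)
    refine (hxn n).trans ?_
    gcongr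
    linarith [hφ (s n)]
  refine ⟨fun n => s n, l, fun n => (s n).2.1, hl, ?_, hxl, ?_⟩
  · refine squeeze_zero (fun n => hφ _) hgeo ?_
    simpa using (tendsto_pow_atTop_nhds_zero_of_lt_one hq0 hq1).const_mul (φ x)
  · have := dist_triangle_left l a x
    linarith

/-- One step of the iteration: moving towards a point slightly short of the target keeps the
residual in the narrow cone. -/
lemma exists_residual_step {X Y : Type*} [PseudoMetricSpace X]
    [NormedAddCommGroup Y] [NormedSpace ℝ Y] {F : X → Set Y} {g : X → Y} {x : X} {y ybar : Y}
    {τ τ' δ α γ L r : ℝ} (hτ : 0 < τ) (hττ' : τ < τ') (hδ : 0 < δ) (hα0 : 0 < α) (hα1 : α < 1)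
    (hγ : γ = α * ‖ybar‖ / (‖ybar‖ + δ * (1 - α))) (hL : 0 < L)
    (hLτ' : L * (τ' * (1 + γ)) < α - γ) (hr : 0 < r)
    (hxr : infEDist (y - g x) (F x) = ENNReal.ofReal r)
    (hxV : y - g x ∈ F x + coneB ybar (δ * (1 - α)))
    (hreg : ∀ z, ‖z - (y - g x)‖ ≤ γ * r → z ∈ F x + coneB ybar δ →
      infEDist x {u | z ∈ F u} ≤ ENNReal.ofReal τ * infEDist z (F x))
    (hg : ∀ u, dist x u ≤ τ' * (1 + γ) * r → ‖g x - g u‖ ≤ L * dist x u) :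
    ∃ u, y - g u ∈ F u + coneB ybar (δ * (1 - α)) ∧ dist x u ≤ τ' * (1 + γ) * r ∧
      infEDist (y - g u) (F u) ≤ ENNReal.ofReal (γ * r + L * dist x u) := by
  have hδ' : 0 < δ * (1 - α) := mul_pos hδ (by linarith)
  have hD : 0 < ‖ybar‖ + δ * (1 - α) := by positivity
  have hγ0 : 0 ≤ γ := by rw [hγ]; positivity
  obtain ⟨v, hv, k, hk, hvk⟩ := Set.mem_add.1 hxV
  have hrk : r ≤ ‖k‖ := by
    have h : infEDist (y - g x) (F x) ≤ edist (y - g x) v :=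
      infEDist_le_edist_of_mem hv
    rw [hxr, edist_dist, dist_eq_norm, ← hvk, add_sub_cancel_left] at h
    exact (ENNReal.ofReal_le_ofReal_iff (norm_nonneg k)).1 h
  set t := α * r / (‖ybar‖ + δ * (1 - α)) with ht
  have ht0 : 0 < t := by positivity
  have htb : t * ‖ybar‖ = γ * r := by rw [ht, hγ]; field_simp
  have htδ : t * (δ * (1 - α)) = (α - γ) * r := by rw [ht, hγ]; field_simp; ring
  have hnt : ‖t • ybar‖ = γ * r := by rw [norm_smul, Real.norm_of_nonneg ht0.le, htb]
  set z := y - g x - t • ybar with hz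
  have hzx : ‖z - (y - g x)‖ = γ * r := by
    rw [hz, sub_sub_cancel_left, norm_neg, hnt]
  have hzV : z ∈ F x + coneB ybar δ := by
    refine Set.mem_add.2 ⟨v, hv, k - t • ybar, sub_smul_mem_coneB hδ hα0 hα1 hr hk hrk, ?_⟩
    rw [hz, ← hvk, add_sub_assoc]
  have hzd : infEDist z (F x) ≤ ENNReal.ofReal ((1 + γ) * r) := by
    calc infEDist z (F x) ≤ infEDist (y - g x) (F x) + edist z (y - g x) :=
          infEDist_le_infEDist_add_edist
      _ = ENNReal.ofReal ((1 + γ) * r) := by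
          rw [hxr, edist_dist, dist_eq_norm, hzx, ← ENNReal.ofReal_add hr.le (by positivity)]
          congr 1; ring
  have hlt : infEDist x {u | z ∈ F u} < ENNReal.ofReal (τ' * (1 + γ) * r) := by
    calc infEDist x {u | z ∈ F u}
        ≤ ENNReal.ofReal τ * infEDist z (F x) := hreg z hzx.le hzV
      _ ≤ ENNReal.ofReal τ * ENNReal.ofReal ((1 + γ) * r) := by gcongr
      _ = ENNReal.ofReal (τ * (1 + γ) * r) := by rw [← ENNReal.ofReal_mul hτ.le, mul_assoc]
      _ < ENNReal.ofReal (τ' * (1 + γ) * r) := by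
          have : 0 < τ' := hτ.trans hττ'
          rw [ENNReal.ofReal_lt_ofReal_iff (by positivity)]
          gcongr
  obtain ⟨u, hu, hxu⟩ := infEDist_lt_iff.1 hlt
  rw [Set.mem_ofPred_eq] at hu
  rw [edist_dist] at hxu
  have hdu : dist x u ≤ τ' * (1 + γ) * r := (ENNReal.ofReal_lt_ofReal_iff'.1 hxu).1.le
  have hgu := hg u hdu
  have hres : y - g u = z + (t • ybar + (g x - g u)) := by rw [hz]; abel
  refine ⟨u, ?_, hdu, ?_⟩
  · rw [hres]
    refine Set.add_mem_add hu (smul_add_mem_coneB ht0 ?_)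
    rw [htδ]
    calc ‖g x - g u‖ ≤ L * (τ' * (1 + γ) * r) := hgu.trans (by gcongr)
      _ = L * (τ' * (1 + γ)) * r := by ring
      _ < (α - γ) * r := by gcongr
  · have h : infEDist (y - g u) (F u) ≤ edist (y - g u) z :=
      infEDist_le_edist_of_mem hu
    refine h.trans ?_
    rw [edist_dist, dist_eq_norm, hres, add_sub_cancel_left]
    refine ENNReal.ofReal_le_ofReal ((norm_add_le _ _).trans ?_)
    rw [hnt]
    gcongr

/-- The regularity estimate for the perturbed multifunction `F + g`, with an arbitrary constant
`τ' > τ` in place of `τ`. -/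
lemma infEDist_perturbed_preimage_le {X Y : Type*} [PseudoMetricSpace X] [CompleteSpace X]
    [NormedAddCommGroup Y] [NormedSpace ℝ Y]
    {F : X → Set Y} (hF : IsClosed {p : X × Y | p.2 ∈ F p.1}) {g : X → Y} {x₀ : X} {y₀ ybar : Y}
    {τ τ' δ α γ L ε η e κ : ℝ} (hτ : 0 < τ) (hττ' : τ < τ') (hδ : 0 < δ) (hα0 : 0 < α)
    (hα1 : α < 1) (hγ : γ = α * ‖ybar‖ / (‖ybar‖ + δ * (1 - α))) (hL : 0 < L)
    (hLτ' : L * (τ' * (1 + γ)) < α - γ)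
    (hreg : ∀ x y, dist (⟨x, y⟩ : X × Y) (x₀, y₀) < ε → y ∈ F x + coneB ybar δ →
      infEDist y (F x) < ENNReal.ofReal ε →
      infEDist x {u | y ∈ F u} ≤ ENNReal.ofReal τ * infEDist y (F x))
    (hg : ∀ x ∈ ball x₀ η, ∀ x' ∈ ball x₀ η, ‖g x - g x'‖ ≤ L * dist x x')
    (hκ : κ = ((1 - γ) / (τ' * (1 + γ)) - L)⁻¹) (he : 0 < e)
    (heη : (1 + κ + 2 * τ') * e ≤ η) (heε : (2 + κ + L * (1 + κ)) * e ≤ ε)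
    {x : X} {y : Y} (hx : x ∈ ball x₀ e) (hy : y ∈ ball (y₀ + g x₀) e)
    (hxy : infEDist (y - g x) (F x) < ENNReal.ofReal e)
    (hV : y - g x ∈ F x + coneB ybar (δ * (1 - α))) :
    infEDist x {u | y - g u ∈ F u} ≤ ENNReal.ofReal κ * infEDist (y - g x) (F x) := by
  have hδ' : 0 < δ * (1 - α) := mul_pos hδ (by linarith)
  have hD : 0 < ‖ybar‖ + δ * (1 - α) := by positivity
  have hγ0 : 0 ≤ γ := by rw [hγ]; positivity
  have hτ' : 0 < τ' := hτ.trans hττ'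
  have hT : 0 < τ' * (1 + γ) := by positivity
  have hγα : γ < α := by linarith [mul_pos hL hT]
  have hm : 0 < (1 - γ) / (τ' * (1 + γ)) - L := by
    rw [sub_pos, lt_div_iff₀ hT]; linarith
  have hκ0 : 0 < κ := by rw [hκ]; exact inv_pos.2 hm
  have hq1 : γ + L * (τ' * (1 + γ)) < 1 := by linarith
  have hfin : ∀ z, y - g z ∈ F z + coneB ybar (δ * (1 - α)) →
      ENNReal.ofReal (infDist (y - g z) (F z)) = infEDist (y - g z) (F z) := fun z hz =>
    ENNReal.ofReal_toReal (infEDist_ne_top (Set.Nonempty.of_add_left ⟨_, hz⟩))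
  let S : Set X := {z | y - g z ∈ F z + coneB ybar (δ * (1 - α)) ∧
    infDist (y - g z) (F z) < e}
  rw [mem_ball] at hx
  rw [mem_ball_iff_norm] at hy
  have hxS : x ∈ S := by
    refine ⟨hV, ?_⟩
    rw [← hfin x hV] at hxy
    exact (ENNReal.ofReal_lt_ofReal_iff he).1 hxy
  have hη : 0 < η := lt_of_lt_of_le (by positivity) heη
  have hstep : ∀ z ∈ S, dist z x₀ + κ * infDist (y - g z) (F z) < (1 + κ) * e →
      ∃ u ∈ S, dist z u ≤ κ * (infDist (y - g z) (F z) - infDist (y - g u) (F u)) ∧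
        infDist (y - g u) (F u) ≤ (γ + L * (τ' * (1 + γ))) * infDist (y - g z) (F z) := by
    rintro z ⟨hzV, hze⟩ hza
    set r := infDist (y - g z) (F z) with hr
    rcases (infDist_nonneg : 0 ≤ r).eq_or_lt with hr' | hr0
    · refine ⟨z, ⟨hzV, hze⟩, ?_, ?_⟩
      · rw [dist_self, ← hr, sub_self, mul_zero]
      · rw [hr, ← hr', mul_zero]
    have hzd : dist z x₀ < (1 + κ) * e := by linarith [mul_pos hκ0 hr0]
    have hzη : z ∈ ball x₀ η := by
      rw [mem_ball]; linarith [mul_pos hτ' he]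
    have hγr : γ * r ≤ e := by nlinarith
    obtain ⟨u, huV, hdu, hur⟩ := exists_residual_step (F := F) (g := g) (x := z) (y := y)
      (ybar := ybar) hτ hττ' hδ hα0 hα1 hγ hL hLτ' hr0 (hfin z hzV).symm hzV
      (by
        intro w hw hwV
        refine hreg z w ?_ hwV ?_
        · rw [Prod.dist_eq]
          refine max_lt ?_ ?_
          · have : 0 < L * (1 + κ) * e := by positivity
            linarith
          · have h1 : ‖g z - g x₀‖ ≤ L * dist z x₀ := hg z hzη x₀ (mem_ball_self hη)
            have h2 : L * dist z x₀ < L * ((1 + κ) * e) := by gcongr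
            have h3 : w - y₀ = (w - (y - g z)) + ((y - (y₀ + g x₀)) - (g z - g x₀)) := by abel
            have h4 := norm_add_le (w - (y - g z)) ((y - (y₀ + g x₀)) - (g z - g x₀))
            have h5 := norm_sub_le (y - (y₀ + g x₀)) (g z - g x₀)
            rw [dist_eq_norm]
            change ‖w - y₀‖ < ε
            rw [h3]
            linarith [mul_pos hκ0 he]
        · calc infEDist w (F z) ≤ infEDist (y - g z) (F z) + edist w (y - g z) :=
                infEDist_le_infEDist_add_edist
            _ = ENNReal.ofReal (r + ‖w - (y - g z)‖) := by
                rw [← hfin z hzV, edist_dist, dist_eq_norm,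
                  ENNReal.ofReal_add infDist_nonneg (norm_nonneg _)]
            _ < ENNReal.ofReal ε := by
                have h1 : 0 < L * (1 + κ) * e := by positivity
                have h2 := mul_pos hκ0 he
                refine (ENNReal.ofReal_lt_ofReal_iff (by linarith)).2 ?_
                linarith)
      (by
        intro u hu
        refine hg z hzη u ?_
        have h1 : τ' * (1 + γ) * r ≤ τ' * 2 * e := by gcongr; linarith
        have h2 := dist_triangle_left u x₀ z
        rw [mem_ball]
        linarith)
    have hur' : infDist (y - g u) (F u) ≤ γ * r + L * dist z u :=
      ENNReal.toReal_le_of_le_ofReal (by positivity) hur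
    have hLd : L * dist z u ≤ L * (τ' * (1 + γ) * r) := by gcongr
    have hq : infDist (y - g u) (F u) ≤ (γ + L * (τ' * (1 + γ))) * r := by linarith
    refine ⟨u, ⟨huV, ?_⟩, ?_, hq⟩
    · have : (γ + L * (τ' * (1 + γ))) * r ≤ 1 * r := by gcongr
      linarith
    · rw [hκ, le_inv_mul_iff₀ hm, sub_mul]
      have : (1 - γ) / (τ' * (1 + γ)) * dist z u ≤ (1 - γ) * r := by
        rw [div_mul_eq_mul_div, div_le_iff₀ hT]
        calc (1 - γ) * dist z u ≤ (1 - γ) * (τ' * (1 + γ) * r) := by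
              gcongr; linarith
          _ = (1 - γ) * r * (τ' * (1 + γ)) := by ring
      linarith
  have hxa : dist x x₀ + κ * infDist (y - g x) (F x) < (1 + κ) * e := by
    have := mul_lt_mul_of_pos_left hxS.2 hκ0
    linarith
  obtain ⟨s, l, hsS, hsl, hs0, hxl, hla⟩ := exists_tendsto_of_residual_decrease
    (φ := fun z => infDist (y - g z) (F z)) (fun z => infDist_nonneg) hκ0.le (by positivity) hq1
    hstep hxS hxa
  have hlη : l ∈ ball x₀ η := by
    rw [mem_ball]; linarith [mul_pos hτ' he]
  have hgs : Tendsto (fun n => g (s n)) atTop (𝓝 (g l)) := by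
    rw [tendsto_iff_norm_sub_tendsto_zero]
    refine squeeze_zero' (Eventually.of_forall fun n => norm_nonneg _) ?_
      (by simpa using (tendsto_iff_dist_tendsto_zero.1 hsl).const_mul L)
    filter_upwards [hsl (isOpen_ball.mem_nhds hlη)] with n hn using hg _ hn _ hlη
  have hv : ∀ n : ℕ, ∃ v ∈ F (s n), dist (y - g (s n)) v <
      infDist (y - g (s n)) (F (s n)) + 1 / ((n : ℝ) + 1) := fun n =>
    (infDist_lt_iff (Set.Nonempty.of_add_left ⟨_, (hsS n).1⟩)).1
      (lt_add_of_pos_right _ Nat.one_div_pos_of_nat)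
  choose v hvF hvd using hv
  have hv0 : Tendsto (fun n => dist (y - g (s n)) (v n)) atTop (𝓝 0) :=
    squeeze_zero (fun n => dist_nonneg) (fun n => (hvd n).le)
      (by simpa using hs0.add (tendsto_one_div_add_atTop_nhds_zero_nat (𝕜 := ℝ)))
  have hvl : Tendsto v atTop (𝓝 (y - g l)) :=
    (tendsto_iff_of_dist hv0).1 (tendsto_const_nhds.sub hgs)
  have hlF : y - g l ∈ F l :=
    hF.mem_of_tendsto (hsl.prodMk_nhds hvl) (Eventually.of_forall hvF)
  have hmem : infEDist x {u | y - g u ∈ F u} ≤ edist x l := infEDist_le_edist_of_mem hlF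
  refine hmem.trans ?_
  rw [edist_dist, ← hfin x hV, ← ENNReal.ofReal_mul hκ0.le]
  exact ENNReal.ofReal_le_ofReal hxl

/-- Theorem on robustness of directional metric regularity: if `F` is
directionally metrically regular in the direction `ybar` with modulus `τ` (with data
`ε, δ`), `α ∈ (0,1)`, `γ = α‖ybar‖/(‖ybar‖+δ(1−α))` and
`0 < L < δ(1−α)α/(τ((1+α)‖ybar‖+δ(1−α)))`, then for every `g` Lipschitz with constant
`L` near `x₀`, `F + g` is directionally metrically regular at `(x₀, y₀ + g(x₀))` in the
direction `ybar` with modulus `((1−γ)/(τ(1+γ)) − L)⁻¹`. -/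
theorem stmt17 {X Y : Type*} [MetricSpace X] [CompleteSpace X]
    [NormedAddCommGroup Y] [NormedSpace ℝ Y]
    (F : X → Set Y) (hF : IsClosed {p : X × Y | p.2 ∈ F p.1})
    (x₀ : X) (y₀ : Y) (h₀ : y₀ ∈ F x₀) (ybar : Y)
    (τ ε δ : ℝ) (hτ : 0 < τ) (hε : 0 < ε) (hδ : 0 < δ)
    (hreg : ∀ x y, dist (⟨x, y⟩ : X × Y) (x₀, y₀) < ε → y ∈ F x + coneB ybar δ →
      EMetric.infEdist y (F x) < ENNReal.ofReal ε →
      EMetric.infEdist x {u | y ∈ F u} ≤ ENNReal.ofReal τ * EMetric.infEdist y (F x))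
    (α : ℝ) (hα0 : 0 < α) (hα1 : α < 1)
    (γ : ℝ) (hγ : γ = α * ‖ybar‖ / (‖ybar‖ + δ * (1 - α)))
    (L : ℝ) (hL0 : 0 < L)
    (hLlt : L < δ * (1 - α) * α / (τ * ((1 + α) * ‖ybar‖ + δ * (1 - α))))
    (g : X → Y)
    (hg : ∃ U ∈ 𝓝 x₀, ∀ x ∈ U, ∀ x' ∈ U, ‖g x - g x'‖ ≤ L * dist x x') :
    DirMetRegMod (fun x => F x + {g x}) x₀ (y₀ + g x₀) ybar
      ((1 - γ) / (τ * (1 + γ)) - L)⁻¹ := by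
  have hδ' : 0 < δ * (1 - α) := mul_pos hδ (by linarith)
  have hD : 0 < ‖ybar‖ + δ * (1 - α) := by positivity
  have hγ0 : 0 ≤ γ := by rw [hγ]; positivity
  have hLτ : L * (τ * (1 + γ)) < α - γ := by
    have hN : 0 < τ * ((1 + α) * ‖ybar‖ + δ * (1 - α)) := by positivity
    rw [lt_div_iff₀ hN] at hLlt
    have h1 : 1 + γ = ((1 + α) * ‖ybar‖ + δ * (1 - α)) / (‖ybar‖ + δ * (1 - α)) := by
      rw [hγ]; field_simp; ring
    have h2 : α - γ = δ * (1 - α) * α / (‖ybar‖ + δ * (1 - α)) := by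
      rw [hγ]; field_simp; ring
    rw [h1, h2, ← mul_div_assoc, ← mul_div_assoc]
    gcongr
  obtain ⟨τ₁, hττ₁, hLτ₁⟩ : ∃ τ₁, τ < τ₁ ∧ L * (τ₁ * (1 + γ)) < α - γ := by
    have hcont : Continuous fun t : ℝ => L * (t * (1 + γ)) := by fun_prop
    have h : ∀ᶠ t in 𝓝[>] τ, L * (t * (1 + γ)) < α - γ :=
      (hcont.continuousAt.eventually_lt_const hLτ).filter_mono nhdsWithin_le_nhds
    exact ((eventually_mem_nhdsWithin (a := τ) (s := Ioi τ)).and h).exists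
  have hτ₁ : 0 < τ₁ := hτ.trans hττ₁
  have hm₁ : 0 < (1 - γ) / (τ₁ * (1 + γ)) - L := by
    rw [sub_pos, lt_div_iff₀ (by positivity)]; linarith
  have hγ1 : γ < 1 := by
    have : 0 < L * (τ * (1 + γ)) := by positivity
    linarith
  have hanti : ∀ t, 0 < t → t ≤ τ₁ →
      (1 - γ) / (τ₁ * (1 + γ)) - L ≤ (1 - γ) / (t * (1 + γ)) - L := by
    intro t ht htτ₁
    have : 0 ≤ 1 - γ := by linarith
    gcongr
  set K := ((1 - γ) / (τ₁ * (1 + γ)) - L)⁻¹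
  have hK0 : 0 < K := inv_pos.2 hm₁
  obtain ⟨U, hU, hgU⟩ := hg
  obtain ⟨η, hη, hηU⟩ := Metric.mem_nhds_iff.1 hU
  obtain ⟨e, he, heη, heε⟩ : ∃ e > 0, (1 + K + 2 * τ₁) * e ≤ η ∧
      (2 + K + L * (1 + K)) * e ≤ ε := by
    refine ⟨min (η / (1 + K + 2 * τ₁)) (ε / (2 + K + L * (1 + K))), ?_, ?_, ?_⟩
    · exact lt_min (by positivity) (by positivity)
    · rw [← le_div_iff₀' (by positivity)]; exact min_le_left _ _
    · rw [← le_div_iff₀' (by positivity)]; exact min_le_right _ _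
  refine ⟨e, he, δ * (1 - α), hδ', fun x y hx hy hxy hV => ?_⟩
  have hset : {u | y ∈ F u + {g u}} = {u | y - g u ∈ F u} := by
    ext u
    simp [Set.add_singleton, sub_eq_add_neg]
  have hV' : y - g x ∈ F x + coneB ybar (δ * (1 - α)) := by
    rw [add_right_comm, Set.add_singleton] at hV
    obtain ⟨w, hw, rfl⟩ := hV
    simpa using hw
  change infEDist y (F x + {g x}) < ENNReal.ofReal e at hxy
  change infEDist x {u | y ∈ F u + {g u}} ≤ _ * infEDist y (F x + {g x})
  rw [infEDist_add_singleton] at hxy ⊢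
  rw [hset]
  have hlim : Tendsto (fun t : ℝ => ENNReal.ofReal ((1 - γ) / (t * (1 + γ)) - L)⁻¹ *
      infEDist (y - g x) (F x)) (𝓝[>] τ)
      (𝓝 (ENNReal.ofReal ((1 - γ) / (τ * (1 + γ)) - L)⁻¹ * infEDist (y - g x) (F x))) := by
    refine ENNReal.Tendsto.mul_const (ENNReal.tendsto_ofReal ?_) (Or.inr hxy.ne_top)
    have hcont : ContinuousAt (fun t : ℝ => ((1 - γ) / (t * (1 + γ)) - L)⁻¹) τ := by
      refine ContinuousAt.inv₀ ?_ (hm₁.trans_le (hanti τ hτ hττ₁.le)).ne'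
      exact (continuousAt_const.div (by fun_prop) (by positivity)).sub continuousAt_const
    exact hcont.tendsto.mono_left nhdsWithin_le_nhds
  refine ge_of_tendsto hlim ?_
  filter_upwards [Ioo_mem_nhdsGT hττ₁] with t ht
  have hκK : ((1 - γ) / (t * (1 + γ)) - L)⁻¹ ≤ K :=
    inv_anti₀ hm₁ (hanti t (hτ.trans ht.1) ht.2.le)
  refine infEDist_perturbed_preimage_le hF hτ ht.1 hδ hα0 hα1 hγ hL0 ?_ hreg
    (fun a ha b hb => hgU a (hηU ha) b (hηU hb)) rfl he ?_ ?_ hx hy hxy hV'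
  · refine lt_of_le_of_lt ?_ hLτ₁
    gcongr
    exact ht.2.le
  · refine le_trans ?_ heη
    gcongr
    exact ht.2.le
  · refine le_trans ?_ heε
    gcongr
end
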